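/- arXiv:1106.5444 — 12 statements merged into one kernel-verified Lean document; each statement's English description precedes it below -/
import Mathlib

section
/- Let f : [0,∞) → [0,∞) be nondecreasing with f(0) = 0 and lim_{x→∞} f(x) = ∞, let f_sup⁻¹(y) = inf{x ≥ 0 : f(x) > y} be its pseudo-inverse, and let K : [0,∞) × [0,∞) → [0,∞) be Lebesgue locally integrable. Then for every pair of nonnegative numbers a < b, ∫_a^b (∫_{f(a)}^{f(x)} K(x,y) dy) dx + ∫_{f(a)}^{f(b)} (∫_a^{f_sup⁻¹(y)} K(x,y) dx) dy = ∫_a^b ∫_{f(a)}^{f(b)} K(x,y) dy dx. -/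
open MeasureTheory Set Filter intervalIntegral

/-- A lower bound for the pseudo-inverse of a monotone function. -/
theorem le_pseudoInverse {f : ℝ → ℝ} (hf : MonotoneOn f (Ici 0)) {b x y : ℝ} (hb : 0 ≤ b)
    (hyb : y < f b) (hx : 0 ≤ x) (hxy : f x ≤ y) : x ≤ sInf {z : ℝ | 0 ≤ z ∧ y < f z} := by
  refine le_csInf ⟨b, hb, hyb⟩ fun z hz => ?_
  by_contra! hzx
  exact absurd (hf hz.1 hx hzx.le) (not_le.2 (hxy.trans_lt hz.2))

/-- The pseudo-inverse at `y` is at most any point where `f` exceeds `y`. -/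
theorem pseudoInverse_le {f : ℝ → ℝ} {x y : ℝ} (hx : 0 ≤ x) (hxy : y < f x) :
    sInf {z : ℝ | 0 ≤ z ∧ y < f z} ≤ x :=
  csInf_le ⟨0, fun _ hz => hz.1⟩ ⟨hx, hxy⟩

/-- The strict hypograph of a function monotone on `[0,∞)`, extended by `f 0` to the left of `0`, is measurable. -/
theorem measurableSet_hypograph {f : ℝ → ℝ} (hf : MonotoneOn f (Ici 0)) :
    MeasurableSet {p : ℝ × ℝ | p.2 < f (max 0 p.1)} := by
  have hg : Monotone fun x => f (max 0 x) := fun x y h =>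
    hf (le_max_left 0 x) (le_max_left 0 y) (max_le_max_left 0 h)
  exact measurableSet_lt measurable_snd (hg.measurable.comp measurable_fst)

/-- Lemma 3 of Mitroi–Niculescu: the hypograph/epigraph decomposition identity for a
nondecreasing function `f` on `[0,∞)` with `f 0 = 0` and `f x → ∞`, its pseudo-inverse
`finv y = inf {x ≥ 0 : f x > y}`, and a locally integrable kernel `K ≥ 0`. -/
theorem young_decomposition (f finv : ℝ → ℝ) (K : ℝ → ℝ → ℝ)
    (hf_mono : MonotoneOn f (Set.Ici 0))
    (hf_nonneg : ∀ x, 0 ≤ x → 0 ≤ f x)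
    (hf0 : f 0 = 0)
    (hf_tendsto : Filter.Tendsto f Filter.atTop Filter.atTop)
    (hfinv : ∀ y, finv y = sInf {x : ℝ | 0 ≤ x ∧ y < f x})
    (hK_nonneg : ∀ x y, 0 ≤ x → 0 ≤ y → 0 ≤ K x y)
    (hK_loc : MeasureTheory.LocallyIntegrableOn (fun p : ℝ × ℝ => K p.1 p.2)
      (Set.Ici (0:ℝ) ×ˢ Set.Ici (0:ℝ)))
    (a b : ℝ) (ha : 0 ≤ a) (hab : a < b) :
    (∫ x in a..b, ∫ y in f a..f x, K x y) +
      (∫ y in f a..f b, ∫ x in a..finv y, K x y) =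
    ∫ x in a..b, ∫ y in f a..f b, K x y := by
  have hb : 0 ≤ b := ha.trans hab.le
  have hfab : f a ≤ f b := hf_mono ha hb hab.le
  set μ := (volume.restrict (Ioc a b)).prod (volume.restrict (Ioc (f a) (f b))) with hμ
  set G : ℝ × ℝ → ℝ := fun p => K p.1 p.2 with hG
  set S : Set (ℝ × ℝ) := {p | p.2 < f (max 0 p.1)} with hS_def
  have hS : MeasurableSet S := measurableSet_hypograph hf_mono
  have hGint : Integrable G μ := by
    have hcpt : IntegrableOn G (Icc a b ×ˢ Icc (f a) (f b)) :=
      hK_loc.integrableOn_compact_subset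
        (prod_mono (fun x hx => ha.trans hx.1) fun y hy => (hf_nonneg a ha).trans hy.1)
        (isCompact_Icc.prod isCompact_Icc)
    rw [hμ, Measure.prod_restrict]
    exact hcpt.mono_set (prod_mono Ioc_subset_Icc_self Ioc_subset_Icc_self)
  have h_hypo : (∫ x in a..b, ∫ y in f a..f x, K x y) = ∫ p in S, G p ∂μ := by
    rw [← MeasureTheory.integral_indicator hS, hμ, integral_prod _ (hGint.indicator hS),
      integral_of_le hab.le]
    refine setIntegral_congr_fun measurableSet_Ioc fun x hx => ?_
    have hx0 : 0 ≤ x := ha.trans hx.1.le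
    have hind : (fun y => S.indicator G (x, y)) = (Iio (f x)).indicator (K x) := by
      ext y
      simp [indicator, hS_def, hG, max_eq_right hx0]
    have hae : (Ioc (f a) (f b) ∩ Iio (f x) : Set ℝ) =ᵐ[volume]
        (Ioc (f a) (f b) ∩ Iic (f x) : Set ℝ) :=
      ae_eq_set_inter ae_eq_rfl Iio_ae_eq_Iic
    simp only [hind]
    rw [setIntegral_indicator measurableSet_Iio,
      setIntegral_congr_set hae, Ioc_inter_Iic,
      min_eq_right (hf_mono hx0 hb hx.2), integral_of_le (hf_mono ha hx0 hx.1.le)]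
  have h_epi : (∫ y in f a..f b, ∫ x in a..finv y, K x y) = ∫ p in Sᶜ, G p ∂μ := by
    rw [← MeasureTheory.integral_indicator hS.compl, hμ,
      integral_prod_symm _ (hGint.indicator hS.compl), integral_of_le hfab]
    refine setIntegral_congr_ae measurableSet_Ioc ?_
    filter_upwards [Measure.ae_ne volume (f b)] with y hyb hy
    have hyb' : y < f b := lt_of_le_of_ne hy.2 hyb
    have ha_le : a ≤ finv y := hfinv y ▸ le_pseudoInverse hf_mono hb hyb' ha hy.1.le
    have hle_b : finv y ≤ b := hfinv y ▸ pseudoInverse_le hb hyb'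
    have hind : (∫ x in Ioc a b, Sᶜ.indicator G (x, y)) =
        ∫ x in Ioc a b, (Iic (finv y)).indicator (fun x => K x y) x := by
      refine setIntegral_congr_ae measurableSet_Ioc ?_
      filter_upwards [Measure.ae_ne volume (finv y)] with x hxy hx
      have hx0 : 0 ≤ x := ha.trans hx.1.le
      have hiff : (x, y) ∈ Sᶜ ↔ x ∈ Iic (finv y) := by
        simp only [hS_def, mem_compl_iff, mem_ofPred_eq, max_eq_right hx0, not_lt, mem_Iic]
        refine ⟨fun h => hfinv y ▸ le_pseudoInverse hf_mono hb hyb' hx0 h, fun h => ?_⟩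
        by_contra! hlt
        exact hxy (le_antisymm h (hfinv y ▸ pseudoInverse_le hx0 hlt))
      simp only [indicator, hiff, hG]
    rw [hind, setIntegral_indicator measurableSet_Iic, Ioc_inter_Iic, min_eq_right hle_b,
      integral_of_le ha_le]
  have h_rect : (∫ x in a..b, ∫ y in f a..f b, K x y) = ∫ p, G p ∂μ := by
    rw [hμ, integral_prod _ hGint, integral_of_le hab.le]
    simp only [integral_of_le hfab, hG]
  rw [h_hypo, h_epi, h_rect, integral_add_compl hS hGint]
end

section
/- (Young's inequality for nondecreasing functions.) Let f : [0,∞) → [0,∞) be nondecreasing with f(0) = 0 and lim_{x→∞} f(x) = ∞, with pseudo-inverse f_sup⁻¹(y) = inf{x ≥ 0 : f(x) > y}, and let K : [0,∞) × [0,∞) → [0,∞) be Lebesgue locally integrable. Then for every pair of nonnegative numbers a < b and every number c ≥ f(a), ∫_a^b ∫_{f(a)}^c K(x,y) dy dx ≤ ∫_a^b (∫_{f(a)}^{f(x)} K(x,y) dy) dx + ∫_{f(a)}^c (∫_a^{f_sup⁻¹(y)} K(x,y) dx) dy. -/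
open MeasureTheory Set Filter intervalIntegral

/-- Fubini's theorem over a region of the plane with prescribed vertical sections. -/
theorem setIntegral_setIntegral_section {k : ℝ × ℝ → ℝ} {s : Set ℝ} {T : ℝ → Set ℝ}
    (hs : MeasurableSet s) (hS : MeasurableSet {p : ℝ × ℝ | p.1 ∈ s ∧ p.2 ∈ T p.1})
    (hk : IntegrableOn k {p : ℝ × ℝ | p.1 ∈ s ∧ p.2 ∈ T p.1}) :
    ∫ x in s, ∫ y in T x, k (x, y) = ∫ p in {p : ℝ × ℝ | p.1 ∈ s ∧ p.2 ∈ T p.1}, k p := by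
  rw [← MeasureTheory.integral_indicator hS, ← MeasureTheory.integral_indicator hs,
    Measure.volume_eq_prod, integral_prod _ ((integrable_indicator_iff hS).2 hk)]
  congr 1
  ext x
  by_cases hx : x ∈ s
  · have hTx : MeasurableSet (T x) := by
      simpa [hx] using (measurable_prodMk_left (x := x)) hS
    rw [Set.indicator_of_mem hx, ← MeasureTheory.integral_indicator hTx]
    congr 1
    ext y
    by_cases hy : y ∈ T x <;> simp [Set.indicator, hx, hy]
  · simp [hx]

/-- Fubini's theorem over a region of the plane with prescribed horizontal sections. -/
theorem setIntegral_setIntegral_section_symm {k : ℝ × ℝ → ℝ} {s : Set ℝ} {T : ℝ → Set ℝ}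
    (hs : MeasurableSet s) (hS : MeasurableSet {p : ℝ × ℝ | p.2 ∈ s ∧ p.1 ∈ T p.2})
    (hk : IntegrableOn k {p : ℝ × ℝ | p.2 ∈ s ∧ p.1 ∈ T p.2}) :
    ∫ y in s, ∫ x in T y, k (x, y) = ∫ p in {p : ℝ × ℝ | p.2 ∈ s ∧ p.1 ∈ T p.2}, k p := by
  rw [← MeasureTheory.integral_indicator hS, ← MeasureTheory.integral_indicator hs,
    Measure.volume_eq_prod, integral_prod_symm _ ((integrable_indicator_iff hS).2 hk)]
  congr 1
  ext y
  by_cases hy : y ∈ s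
  · have hTy : MeasurableSet (T y) := by
      simpa [hy] using (measurable_prodMk_right (y := y)) hS
    rw [Set.indicator_of_mem hy, ← MeasureTheory.integral_indicator hTy]
    congr 1
    ext x
    by_cases hx : x ∈ T y <;> simp [Set.indicator, hy, hx]
  · simp [hy]

/-- Young's inequality for nondecreasing functions (Theorem 1 of Mitroi–Niculescu). -/
theorem young_inequality_nondecreasing (f finv : ℝ → ℝ) (K : ℝ → ℝ → ℝ)
    (hf_mono : MonotoneOn f (Set.Ici 0))
    (hf_nonneg : ∀ x, 0 ≤ x → 0 ≤ f x)
    (hf0 : f 0 = 0)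
    (hf_tendsto : Filter.Tendsto f Filter.atTop Filter.atTop)
    (hfinv : ∀ y, finv y = sInf {x : ℝ | 0 ≤ x ∧ y < f x})
    (hK_nonneg : ∀ x y, 0 ≤ x → 0 ≤ y → 0 ≤ K x y)
    (hK_loc : MeasureTheory.LocallyIntegrableOn (fun p : ℝ × ℝ => K p.1 p.2)
      (Set.Ici (0:ℝ) ×ˢ Set.Ici (0:ℝ)))
    (a b c : ℝ) (ha : 0 ≤ a) (hab : a < b) (hc : f a ≤ c) :
    (∫ x in a..b, ∫ y in f a..c, K x y) ≤
      (∫ x in a..b, ∫ y in f a..f x, K x y) +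
        ∫ y in f a..c, ∫ x in a..finv y, K x y := by
  have hne (y : ℝ) : {x : ℝ | 0 ≤ x ∧ y < f x}.Nonempty :=
    ((eventually_ge_atTop 0).and (hf_tendsto.eventually_gt_atTop y)).exists
  have hbdd (y : ℝ) : BddBelow {x : ℝ | 0 ≤ x ∧ y < f x} := ⟨0, fun _ hx => hx.1⟩
  have hfinv_mono : Monotone finv := fun y z hyz => by
    rw [hfinv, hfinv]
    exact csInf_le_csInf (hbdd y) (hne z) fun x hx => ⟨hx.1, hyz.trans_lt hx.2⟩
  have le_finv {x y : ℝ} (hx : 0 ≤ x) (hxy : f x ≤ y) : x ≤ finv y := by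
    rw [hfinv]
    refine le_csInf (hne y) fun z hz => ?_
    by_contra! hzx
    exact (hz.2.trans_le ((hf_mono hz.1 hx hzx.le).trans hxy)).false
  have hg_meas : Measurable fun x => f (max x 0) := Monotone.measurable fun x y hxy =>
    hf_mono (le_max_right x 0) (le_max_right y 0) (max_le_max_right 0 hxy)
  have hfa : 0 ≤ f a := hf_nonneg a ha
  have f_le {x : ℝ} (hx : x ∈ Ioc a b) : f a ≤ f x :=
    hf_mono ha (ha.trans hx.1.le) hx.1.le
  let k : ℝ × ℝ → ℝ := fun p => K p.1 p.2
  let R : Set (ℝ × ℝ) := Icc 0 (max b (finv c)) ×ˢ Icc 0 (max c (f b))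
  have hkR : IntegrableOn k R := hK_loc.integrableOn_compact_subset
    (Set.prod_mono Icc_subset_Ici_self Icc_subset_Ici_self) (isCompact_Icc.prod isCompact_Icc)
  let A : Set (ℝ × ℝ) := {p | p.1 ∈ Ioc a b ∧ p.2 ∈ Ioc (f a) c}
  let B : Set (ℝ × ℝ) := {p | p.1 ∈ Ioc a b ∧ p.2 ∈ Ioc (f a) (f p.1)}
  let C : Set (ℝ × ℝ) := {p | p.2 ∈ Ioc (f a) c ∧ p.1 ∈ Ioc a (finv p.2)}
  have hAm : MeasurableSet A := measurableSet_Ioc.prod measurableSet_Ioc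
  have hBm : MeasurableSet B := by
    have hB' : B = {p : ℝ × ℝ | p.1 ∈ Ioc a b ∧ f a < p.2 ∧ p.2 ≤ f (max p.1 0)} := by
      ext p
      refine and_congr_right fun hp => ?_
      rw [max_eq_left (ha.trans hp.1.le), mem_Ioc]
    rw [hB']
    exact (measurable_fst measurableSet_Ioc).inter
      ((measurableSet_lt measurable_const measurable_snd).inter
        (measurableSet_le measurable_snd (hg_meas.comp measurable_fst)))
  have hCm : MeasurableSet C :=
    (measurable_snd measurableSet_Ioc).inter
      ((measurableSet_lt measurable_const measurable_fst).inter
        (measurableSet_le measurable_fst (hfinv_mono.measurable.comp measurable_snd)))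
  have hBR : B ⊆ R := fun p hp =>
    ⟨⟨ha.trans hp.1.1.le, hp.1.2.trans (le_max_left _ _)⟩, hfa.trans hp.2.1.le,
      (hp.2.2.trans (hf_mono (ha.trans hp.1.1.le) (ha.trans hab.le) hp.1.2)).trans
        (le_max_right _ _)⟩
  have hCR : C ⊆ R := fun p hp =>
    ⟨⟨ha.trans hp.2.1.le, (hp.2.2.trans (hfinv_mono hp.1.2)).trans (le_max_right _ _)⟩,
      hfa.trans hp.1.1.le, hp.1.2.trans (le_max_left _ _)⟩
  have hABC : A ⊆ B ∪ C := fun p hp => by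
    rcases le_or_gt p.2 (f p.1) with h | h
    · exact Or.inl ⟨hp.1, hp.2.1, h⟩
    · exact Or.inr ⟨hp.2, hp.1.1, le_finv (ha.trans hp.1.1.le) h.le⟩
  have hkB : IntegrableOn k B := hkR.mono_set hBR
  have hkC : IntegrableOn k C := hkR.mono_set hCR
  have hkBC : IntegrableOn k (B ∪ C) := hkB.union hkC
  have hk_nonneg : ∀ p ∈ R, 0 ≤ k p := fun p hp => hK_nonneg _ _ hp.1.1 hp.2.1
  have hIA : (∫ x in a..b, ∫ y in f a..c, K x y) = ∫ p in A, k p := by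
    simp only [integral_of_le hab.le, integral_of_le hc]
    exact setIntegral_setIntegral_section (k := k) (T := fun _ => Ioc (f a) c)
      measurableSet_Ioc hAm (hkBC.mono_set hABC)
  have hIB : (∫ x in a..b, ∫ y in f a..f x, K x y) = ∫ p in B, k p := by
    rw [integral_of_le hab.le, setIntegral_congr_fun measurableSet_Ioc
      fun x hx => integral_of_le (f_le hx)]
    exact setIntegral_setIntegral_section (k := k) (T := fun x => Ioc (f a) (f x))
      measurableSet_Ioc hBm hkB
  have hIC : (∫ y in f a..c, ∫ x in a..finv y, K x y) = ∫ p in C, k p := by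
    rw [integral_of_le hc, setIntegral_congr_fun measurableSet_Ioc
      fun y hy => integral_of_le (le_finv ha hy.1.le)]
    exact setIntegral_setIntegral_section_symm (k := k) (T := fun y => Ioc a (finv y))
      measurableSet_Ioc hCm hkC
  rw [hIA, hIB, hIC]
  calc ∫ p in A, k p ≤ ∫ p in B ∪ C, k p :=
        setIntegral_mono_set hkBC
          ((ae_restrict_mem (hBm.union hCm)).mono fun p hp =>
            hk_nonneg p (union_subset hBR hCR hp)) hABC.eventuallyLE
    _ = (∫ p in B, k p) + ∫ p in C \ B, k p := by
        rw [← union_sdiff_self, setIntegral_union disjoint_sdiff_right (hCm.diff hBm) hkB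
          (hkC.mono_set sdiff_subset)]
    _ ≤ (∫ p in B, k p) + ∫ p in C, k p := by
        refine add_le_add le_rfl (setIntegral_mono_set hkC
          ((ae_restrict_mem hCm).mono fun p hp => hk_nonneg p (hCR hp))
          (sdiff_subset : C \ B ⊆ C).eventuallyLE)
end

section
/- (Equality case in Young's inequality for nondecreasing functions.) Let f : [0,∞) → [0,∞) be nondecreasing with f(0) = 0 and lim_{x→∞} f(x) = ∞, with pseudo-inverse f_sup⁻¹(y) = inf{x ≥ 0 : f(x) > y}, and let K : [0,∞) × [0,∞) → [0,∞) be Lebesgue locally integrable and strictly positive almost everywhere. Then for nonnegative numbers a < b and c ≥ f(a), equality ∫_a^b ∫_{f(a)}^c K(x,y) dy dx = ∫_a^b (∫_{f(a)}^{f(x)} K(x,y) dy) dx + ∫_{f(a)}^c (∫_a^{f_sup⁻¹(y)} K(x,y) dx) dy holds if and only if c lies in the interval [f(b−), f(b+)], where f(b−) and f(b+) denote the left and right limits of f at b. -/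
open MeasureTheory Set Filter intervalIntegral

/-- Fubini for the region lying between the constant `d` and the graph of `g`, over `I`. -/
theorem setIntegral_regionBetween_const {K : ℝ → ℝ → ℝ} {I : Set ℝ} {g : ℝ → ℝ} {d : ℝ}
    (hI : MeasurableSet I) (hg : Measurable g)
    (hK : IntegrableOn (fun p : ℝ × ℝ => K p.1 p.2) {p | p.1 ∈ I ∧ p.2 ∈ Ioc d (g p.1)}) :
    MeasurableSet {p : ℝ × ℝ | p.1 ∈ I ∧ p.2 ∈ Ioc d (g p.1)} ∧
    ∫ x in I, ∫ y in Ioc d (g x), K x y =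
      ∫ p in {p : ℝ × ℝ | p.1 ∈ I ∧ p.2 ∈ Ioc d (g p.1)}, K p.1 p.2 := by
  have hS : MeasurableSet {p : ℝ × ℝ | p.1 ∈ I ∧ p.2 ∈ Ioc d (g p.1)} :=
    (measurable_fst hI).inter ((measurableSet_lt measurable_const measurable_snd).inter
      (measurableSet_le measurable_snd (hg.comp measurable_fst)))
  refine ⟨hS, ?_⟩
  rw [← MeasureTheory.integral_indicator hS, Measure.volume_eq_prod, integral_prod _
    ((integrable_indicator_iff hS).2 hK), ← MeasureTheory.integral_indicator hI]
  refine integral_congr_ae (.of_forall fun x => ?_)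
  by_cases hx : x ∈ I
  · simp only [indicator_of_mem hx]
    rw [← MeasureTheory.integral_indicator measurableSet_Ioc]
    simp [indicator, hx]
  · simp [indicator, hx]

/-- The same as `setIntegral_regionBetween_const` with the two variables exchanged. -/
theorem setIntegral_regionBetween_const_swap {K : ℝ → ℝ → ℝ} {J : Set ℝ} {h : ℝ → ℝ} {d : ℝ}
    (hJ : MeasurableSet J) (hh : Measurable h)
    (hK : IntegrableOn (fun p : ℝ × ℝ => K p.1 p.2) {p | p.2 ∈ J ∧ p.1 ∈ Ioc d (h p.2)}) :
    MeasurableSet {p : ℝ × ℝ | p.2 ∈ J ∧ p.1 ∈ Ioc d (h p.2)} ∧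
    ∫ y in J, ∫ x in Ioc d (h y), K x y =
      ∫ p in {p : ℝ × ℝ | p.2 ∈ J ∧ p.1 ∈ Ioc d (h p.2)}, K p.1 p.2 := by
  have hS : MeasurableSet {p : ℝ × ℝ | p.2 ∈ J ∧ p.1 ∈ Ioc d (h p.2)} :=
    (measurable_snd hJ).inter ((measurableSet_lt measurable_const measurable_fst).inter
      (measurableSet_le measurable_fst (hh.comp measurable_snd)))
  refine ⟨hS, ?_⟩
  rw [← MeasureTheory.integral_indicator hS, Measure.volume_eq_prod, integral_prod_symm _
    ((integrable_indicator_iff hS).2 hK), ← MeasureTheory.integral_indicator hJ]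
  refine integral_congr_ae (.of_forall fun y => ?_)
  by_cases hy : y ∈ J
  · simp only [indicator_of_mem hy]
    rw [← MeasureTheory.integral_indicator measurableSet_Ioc]
    simp [indicator, hy]
  · simp [indicator, hy]

theorem ae_snd_ne_graph {g : ℝ → ℝ} (hg : Measurable g) : ∀ᵐ p : ℝ × ℝ, p.2 ≠ g p.1 := by
  have hS : MeasurableSet {p : ℝ × ℝ | p.2 = g p.1} :=
    measurableSet_eq_fun measurable_snd (hg.comp measurable_fst)
  rw [ae_iff]
  simp only [ne_eq, not_not]
  rw [Measure.volume_eq_prod, Measure.measure_prod_null hS]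
  exact .of_forall fun x => by simp [preimage]

theorem ae_fst_ne_graph {h : ℝ → ℝ} (hh : Measurable h) : ∀ᵐ p : ℝ × ℝ, p.1 ≠ h p.2 := by
  have := (Measure.measurePreserving_swap (μ := (volume : Measure ℝ))
    (ν := (volume : Measure ℝ))).quasiMeasurePreserving.ae (ae_snd_ne_graph hh)
  exact this

/-- If `S₀ ⊆ S₁ ∪ S₂` and `S₁`, `S₂` are almost disjoint, the integrals of an a.e. positive
function over `S₁` and `S₂` add up to its integral over `S₀` iff `(S₁ ∪ S₂) \ S₀` is null. -/
theorem setIntegral_eq_add_iff_measure_diff_eq_zero {α : Type*} [MeasurableSpace α]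
    {μ : Measure α} {F : α → ℝ} {S₀ S₁ S₂ : Set α} (h₀ : MeasurableSet S₀)
    (h₁ : MeasurableSet S₁) (h₂ : MeasurableSet S₂) (hsub : S₀ ⊆ S₁ ∪ S₂)
    (hdisj : AEDisjoint μ S₁ S₂) (hF₁ : IntegrableOn F S₁ μ) (hF₂ : IntegrableOn F S₂ μ)
    (hpos : ∀ᵐ p ∂μ, p ∈ S₁ ∪ S₂ → 0 < F p) :
    ∫ p in S₀, F p ∂μ = ∫ p in S₁, F p ∂μ + ∫ p in S₂, F p ∂μ ↔ μ ((S₁ ∪ S₂) \ S₀) = 0 := by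
  have hU := hF₁.union hF₂
  have hD : MeasurableSet ((S₁ ∪ S₂) \ S₀) := (h₁.union h₂).diff h₀
  rw [← setIntegral_union₀ hdisj h₂.nullMeasurableSet hF₁ hF₂]
  have hdiff := setIntegral_sdiff h₀ hU hsub
  have hpos' : ∀ᵐ p ∂μ.restrict ((S₁ ∪ S₂) \ S₀), 0 < F p := by
    rw [ae_restrict_iff' hD]
    filter_upwards [hpos] with p hp hpD using hp hpD.1
  have hzero := integral_eq_zero_iff_of_nonneg_ae (hpos'.mono fun p hp => hp.le)
    (hU.mono_set sdiff_subset)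
  constructor
  · intro h
    have h0 := hzero.1 (by rw [hdiff, h, sub_self])
    have : ∀ᵐ p ∂μ.restrict ((S₁ ∪ S₂) \ S₀), False := by
      filter_upwards [h0, hpos'] with p hp hp' using hp'.ne' hp
    simpa [ae_iff] using this
  · intro h
    have := setIntegral_measure_zero F h
    linarith

/-- The set whose integral is the deficit in Young's inequality is null exactly when `c` lies
between the one-sided limits. -/
theorem volume_young_diff_eq_zero_iff {g h : ℝ → ℝ} {a b c : ℝ} (hg : Monotone g)
    (hgh : ∀ x y, g a ≤ y → a < x → x < h y → g x ≤ y)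
    (hhg : ∀ x y, g a ≤ y → a < x → h y < x → y < g x) (hab : a < b) (hc : g a ≤ c) :
    volume (({p : ℝ × ℝ | p.1 ∈ Ioc a b ∧ p.2 ∈ Ioc (g a) (g p.1)} ∪
        {p : ℝ × ℝ | p.2 ∈ Ioc (g a) c ∧ p.1 ∈ Ioc a (h p.2)}) \
        {p : ℝ × ℝ | p.1 ∈ Ioc a b ∧ p.2 ∈ Ioc (g a) c}) = 0 ↔
      c ∈ Icc (Function.leftLim g b) (Function.rightLim g b) := by
  constructor
  · intro hnull
    by_contra hcon
    rw [mem_Icc, not_and_or, not_le, not_le] at hcon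
    have key : ∀ u v w z : ℝ, u < v → w < z →
        ¬ (Ioo u v ×ˢ Ioo w z ⊆ (({p : ℝ × ℝ | p.1 ∈ Ioc a b ∧ p.2 ∈ Ioc (g a) (g p.1)} ∪
        {p : ℝ × ℝ | p.2 ∈ Ioc (g a) c ∧ p.1 ∈ Ioc a (h p.2)}) \
        {p : ℝ × ℝ | p.1 ∈ Ioc a b ∧ p.2 ∈ Ioc (g a) c})) := by
      intro u v w z huv hwz hsub
      have := measure_mono_null hsub hnull
      rw [Measure.volume_eq_prod, Measure.prod_prod] at this
      simp [huv.not_ge, hwz.not_ge] at this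
    rcases hcon with hlt | hlt
    · obtain ⟨x₀, hx₀, hax₀, hx₀b⟩ := (((hg.tendsto_leftLim b).eventually
        (lt_mem_nhds hlt)).and (Ioo_mem_nhdsLT hab)).exists
      refine key x₀ b c (g x₀) hx₀b hx₀ ?_
      rintro ⟨x, y⟩ ⟨⟨hx1, hx2⟩, hy1, hy2⟩
      have := hg hx1.le
      simp only at *
      refine ⟨.inl ⟨⟨by linarith, hx2.le⟩, by simp only; linarith, by simp only; linarith⟩, ?_⟩
      rintro ⟨-, -, hy⟩
      exact absurd hy (not_le.2 hy1)
    · obtain ⟨x₁, hx₁, hbx₁⟩ := (((hg.tendsto_rightLim b).eventually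
        (gt_mem_nhds hlt)).and self_mem_nhdsWithin).exists
      have hga := hg (hab.trans hbx₁).le
      refine key b x₁ (g x₁) c hbx₁ hx₁ ?_
      rintro ⟨x, y⟩ ⟨⟨hx1, hx2⟩, hy1, hy2⟩
      simp only at *
      have hle : x₁ ≤ h y := by
        by_contra! hcon
        have := hhg x₁ y (by linarith) (by linarith) hcon
        linarith
      refine ⟨.inr ⟨⟨by simp only; linarith, hy2.le⟩, by simp only; linarith,
        by simp only; linarith⟩, ?_⟩
      rintro ⟨⟨-, hx⟩, -⟩
      exact absurd hx (not_le.2 hx1)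
  · rintro ⟨hl, hr⟩
    rw [measure_eq_zero_iff_ae_notMem]
    filter_upwards [ae_fst_ne_graph (measurable_const (a := b)),
      ae_snd_ne_graph (measurable_const (a := c))] with ⟨x, y⟩ hxb hyc
    simp only at hxb hyc
    rintro ⟨⟨⟨hax, hxb'⟩, hy1, hy2⟩ | ⟨⟨hy1, hy2⟩, hax, hxh⟩, hnot⟩ <;> simp only at *
    · have := hg.le_leftLim (lt_of_le_of_ne hxb' hxb)
      exact hnot ⟨⟨hax, hxb'⟩, hy1, by simp only; linarith⟩
    · by_cases hx : x ≤ b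
      · exact hnot ⟨⟨hax, hx⟩, hy1, hy2⟩
      · obtain ⟨x', hx1, hx2⟩ := exists_between (not_le.1 hx)
        have h1 := hgh x' y hy1.le (by linarith) (by linarith)
        have h2 := hg.rightLim_le hx1
        exact hyc (by linarith)

/-- Equality case in Young's inequality for nondecreasing functions: when the kernel `K`
is strictly positive a.e., equality holds iff `c` lies between the one-sided limits of
`f` at `b`. -/
theorem young_inequality_equality_case (f finv : ℝ → ℝ) (K : ℝ → ℝ → ℝ)
    (hf_mono : MonotoneOn f (Set.Ici 0))
    (hf_nonneg : ∀ x, 0 ≤ x → 0 ≤ f x)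
    (hf0 : f 0 = 0)
    (hf_tendsto : Filter.Tendsto f Filter.atTop Filter.atTop)
    (hfinv : ∀ y, finv y = sInf {x : ℝ | 0 ≤ x ∧ y < f x})
    (hK_nonneg : ∀ x y, 0 ≤ x → 0 ≤ y → 0 ≤ K x y)
    (hK_loc : MeasureTheory.LocallyIntegrableOn (fun p : ℝ × ℝ => K p.1 p.2)
      (Set.Ici (0:ℝ) ×ˢ Set.Ici (0:ℝ)))
    (hK_pos : ∀ᵐ p : ℝ × ℝ, p ∈ Set.Ici (0:ℝ) ×ˢ Set.Ici (0:ℝ) → 0 < K p.1 p.2)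
    (a b c : ℝ) (ha : 0 ≤ a) (hab : a < b) (hc : f a ≤ c) :
    (∫ x in a..b, ∫ y in f a..c, K x y) =
      (∫ x in a..b, ∫ y in f a..f x, K x y) +
        (∫ y in f a..c, ∫ x in a..finv y, K x y) ↔
      c ∈ Set.Icc (Function.leftLim f b) (Function.rightLim f b) := by
  obtain ⟨g, hg, hgf⟩ : ∃ g : ℝ → ℝ, Monotone g ∧ ∀ x, 0 ≤ x → g x = f x :=
    ⟨fun x => f (max x 0), fun x y hxy => hf_mono (mem_Ici.2 (le_max_right _ _)) (mem_Ici.2 (le_max_right _ _))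
      (max_le_max_right 0 hxy), fun x hx => by simp only [max_eq_left hx]⟩
  have hb : 0 < b := ha.trans_lt hab
  have hev : g =ᶠ[nhds b] f := by
    filter_upwards [lt_mem_nhds hb] with x hx using hgf x hx.le
  have hleft : Function.leftLim f b = Function.leftLim g b :=
    leftLim_eq_of_tendsto
      ((hg.tendsto_leftLim b).congr' (hev.filter_mono nhdsWithin_le_nhds))
  have hright : Function.rightLim f b = Function.rightLim g b :=
    rightLim_eq_of_tendsto
      ((hg.tendsto_rightLim b).congr' (hev.filter_mono nhdsWithin_le_nhds))
  have hne : ∀ y, {x : ℝ | 0 ≤ x ∧ y < f x}.Nonempty := fun y =>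
    ((eventually_ge_atTop 0).and (hf_tendsto.eventually_gt_atTop y)).exists
  have hbdd : ∀ y, BddBelow {x : ℝ | 0 ≤ x ∧ y < f x} := fun y => ⟨0, fun x hx => hx.1⟩
  have hfinv_mono : Monotone finv := fun y z hyz => by
    rw [hfinv, hfinv]
    exact csInf_le_csInf (hbdd y) (hne z) fun x hx => ⟨hx.1, hyz.trans_lt hx.2⟩
  have hgh : ∀ x y, 0 ≤ x → x < finv y → g x ≤ y := by
    intro x y hx hxy
    by_contra! hcon
    rw [hfinv] at hxy
    exact notMem_of_lt_csInf hxy (hbdd y) ⟨hx, hgf x hx ▸ hcon⟩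
  have hhg : ∀ x y, 0 ≤ x → finv y < x → y < g x := by
    intro x y hx hxy
    rw [hfinv] at hxy
    obtain ⟨x', ⟨hx'0, hx'⟩, hlt⟩ := exists_lt_of_csInf_lt (hne y) hxy
    rw [hgf x hx]
    exact hx'.trans_le (hf_mono hx'0 hx hlt.le)
  have hainv : ∀ y, g a ≤ y → a ≤ finv y := by
    intro y hy
    by_contra! hcon
    exact (hhg a y ha hcon).not_ge hy
  have hga : f a = g a := (hgf a ha).symm
  have hga0 : 0 ≤ g a := hga ▸ hf_nonneg a ha
  rw [hga] at hc ⊢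
  rw [hleft, hright]
  have hint : ∀ S : Set (ℝ × ℝ), S ⊆ Icc a (max b (finv c)) ×ˢ Icc (g a) (max c (g b)) →
      IntegrableOn (fun p : ℝ × ℝ => K p.1 p.2) S := fun S hS =>
    (hK_loc.integrableOn_compact_subset
      (prod_mono (fun x hx => ha.trans hx.1) fun y hy => hga0.trans hy.1)
      (isCompact_Icc.prod isCompact_Icc)).mono_set hS
  have hint₀ := hint {p | p.1 ∈ Ioc a b ∧ p.2 ∈ Ioc (g a) c} fun p hp =>
    ⟨⟨hp.1.1.le, hp.1.2.trans (le_max_left _ _)⟩, hp.2.1.le, hp.2.2.trans (le_max_left _ _)⟩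
  have hint₁ := hint {p | p.1 ∈ Ioc a b ∧ p.2 ∈ Ioc (g a) (g p.1)} fun p hp =>
    ⟨⟨hp.1.1.le, hp.1.2.trans (le_max_left _ _)⟩, hp.2.1.le,
      (hp.2.2.trans (hg hp.1.2)).trans (le_max_right _ _)⟩
  have hint₂ := hint {p | p.2 ∈ Ioc (g a) c ∧ p.1 ∈ Ioc a (finv p.2)} fun p hp =>
    ⟨⟨hp.2.1.le, (hp.2.2.trans (hfinv_mono hp.1.2)).trans (le_max_right _ _)⟩, hp.1.1.le,
      hp.1.2.trans (le_max_left _ _)⟩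
  obtain ⟨hS₀, hI₀⟩ := setIntegral_regionBetween_const measurableSet_Ioc
    (measurable_const (a := c)) hint₀
  obtain ⟨hS₁, hI₁⟩ := setIntegral_regionBetween_const measurableSet_Ioc hg.measurable hint₁
  obtain ⟨hS₂, hI₂⟩ := setIntegral_regionBetween_const_swap measurableSet_Ioc
    hfinv_mono.measurable hint₂
  have e₀ : (∫ x in a..b, ∫ y in g a..c, K x y) =
      ∫ x in Ioc a b, ∫ y in Ioc (g a) c, K x y := by
    simp only [integral_of_le hab.le, integral_of_le hc]
  have e₁ : (∫ x in a..b, ∫ y in g a..f x, K x y) =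
      ∫ x in Ioc a b, ∫ y in Ioc (g a) (g x), K x y := by
    rw [integral_of_le hab.le]
    refine setIntegral_congr_fun measurableSet_Ioc fun x hx => ?_
    simp only [← hgf x (ha.trans hx.1.le), integral_of_le (hg hx.1.le)]
  have e₂ : (∫ y in g a..c, ∫ x in a..finv y, K x y) =
      ∫ y in Ioc (g a) c, ∫ x in Ioc a (finv y), K x y := by
    rw [integral_of_le hc]
    refine setIntegral_congr_fun measurableSet_Ioc fun y hy => ?_
    simp only [integral_of_le (hainv y hy.1.le)]
  rw [e₀, e₁, e₂, hI₀, hI₁, hI₂, setIntegral_eq_add_iff_measure_diff_eq_zero hS₀ hS₁ hS₂ ?_ ?_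
    hint₁ hint₂ ?_]
  · exact volume_young_diff_eq_zero_iff hg (fun x y _ hx => hgh x y (ha.trans hx.le))
      (fun x y _ hx => hhg x y (ha.trans hx.le)) hab hc
  · rintro ⟨x, y⟩ ⟨hx, hy⟩
    by_cases hxy : y ≤ g x
    · exact .inl ⟨hx, hy.1, hxy⟩
    · refine .inr ⟨hy, hx.1, ?_⟩
      by_contra hcon
      exact hxy (hhg x y (ha.trans hx.1.le) (not_le.1 hcon)).le
  · rw [AEDisjoint, measure_eq_zero_iff_ae_notMem]
    filter_upwards [ae_fst_ne_graph hfinv_mono.measurable, ae_snd_ne_graph hg.measurable]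
      with p h1 h2
    rintro ⟨⟨hx, hy⟩, hy', hx'⟩
    exact h2 (hy.2.antisymm (hgh _ _ (ha.trans hx.1.le) (lt_of_le_of_ne hx'.2 h1)))
  · filter_upwards [hK_pos] with p hp hpS
    rcases hpS with ⟨hx, hy⟩ | ⟨hy, hx⟩ <;>
      exact hp ⟨ha.trans hx.1.le, hga0.trans hy.1.le⟩
end

section
/- (Young's inequality for continuous increasing functions.) Let f : [0,∞) → [0,∞) be continuous and strictly increasing with f(0) = 0 and lim_{x→∞} f(x) = ∞, and let K : [0,∞) × [0,∞) → [0,∞) be Lebesgue locally integrable. Then for all nonnegative numbers a < b and every real number c ≥ f(a), ∫_a^b ∫_{f(a)}^c K(x,y) dy dx ≤ ∫_a^b (∫_{f(a)}^{f(x)} K(x,y) dy) dx + ∫_{f(a)}^c (∫_a^{f⁻¹(y)} K(x,y) dx) dy. If moreover K is strictly positive almost everywhere, equality occurs if and only if c = f(b). -/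
open MeasureTheory Set Filter intervalIntegral

/-- **Fubini's theorem** over the region lying over `A` with fibres `B x`. -/
theorem setIntegral_region_eq {F : ℝ × ℝ → ℝ} {A : Set ℝ} {B : ℝ → Set ℝ}
    (hA : MeasurableSet A) (hS : MeasurableSet {p : ℝ × ℝ | p.1 ∈ A ∧ p.2 ∈ B p.1})
    (hF : IntegrableOn F {p : ℝ × ℝ | p.1 ∈ A ∧ p.2 ∈ B p.1}) :
    ∫ p in {p : ℝ × ℝ | p.1 ∈ A ∧ p.2 ∈ B p.1}, F p = ∫ x in A, ∫ y in B x, F (x, y) := by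
  rw [← MeasureTheory.integral_indicator hS, Measure.volume_eq_prod, integral_prod, ← MeasureTheory.integral_indicator hA]
  · refine integral_congr_ae (Eventually.of_forall fun x => ?_)
    by_cases hx : x ∈ A
    · have hB : MeasurableSet (B x) := by
        simpa [Set.preimage, hx] using measurable_prodMk_left (x := x) hS
      simp only [indicator_of_mem hx]
      rw [← MeasureTheory.integral_indicator hB]
      refine integral_congr_ae (Eventually.of_forall fun y => ?_)
      by_cases hy : y ∈ B x <;> simp [hx, hy]
    · simp [hx]
  · rw [← Measure.volume_eq_prod]
    exact hF.integrable_indicator hS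

/-- **Fubini's theorem** over the region lying over `A`, in the second variable, with fibres
`B y`. -/
theorem setIntegral_region_eq_symm {F : ℝ × ℝ → ℝ} {A : Set ℝ} {B : ℝ → Set ℝ}
    (hA : MeasurableSet A) (hS : MeasurableSet {p : ℝ × ℝ | p.2 ∈ A ∧ p.1 ∈ B p.2})
    (hF : IntegrableOn F {p : ℝ × ℝ | p.2 ∈ A ∧ p.1 ∈ B p.2}) :
    ∫ p in {p : ℝ × ℝ | p.2 ∈ A ∧ p.1 ∈ B p.2}, F p = ∫ y in A, ∫ x in B y, F (x, y) := by
  rw [← MeasureTheory.integral_indicator hS, Measure.volume_eq_prod, integral_prod_symm,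
    ← MeasureTheory.integral_indicator hA]
  · refine integral_congr_ae (Eventually.of_forall fun y => ?_)
    by_cases hy : y ∈ A
    · have hB : MeasurableSet (B y) := by
        simpa [Set.preimage, hy] using measurable_prodMk_right (y := y) hS
      simp only [indicator_of_mem hy]
      rw [← MeasureTheory.integral_indicator hB]
      refine integral_congr_ae (Eventually.of_forall fun x => ?_)
      by_cases hx : x ∈ B y <;> simp [hx, hy]
    · simp [hy]
  · rw [← Measure.volume_eq_prod]
    exact hF.integrable_indicator hS

/-- The graph of a measurable function is a null set in the plane. -/
theorem volume_graph_eq_zero {φ : ℝ → ℝ} (hφ : Measurable φ) :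
    volume {p : ℝ × ℝ | p.2 = φ p.1} = 0 := by
  have hm : MeasurableSet {p : ℝ × ℝ | p.2 = φ p.1} :=
    measurableSet_eq_fun measurable_snd (hφ.comp measurable_fst)
  rw [Measure.volume_eq_prod, Measure.measure_prod_null hm]
  exact Eventually.of_forall fun x => by simp [Set.preimage]

/-- If `F` is positive almost everywhere on `S` and `S` contains a nondegenerate open rectangle,
then the integral of `F` over `S` does not vanish. -/
theorem setIntegral_ne_zero_of_rectangle_subset {F : ℝ × ℝ → ℝ} {S : Set (ℝ × ℝ)}
    (hS : MeasurableSet S) (hF : IntegrableOn F S) (hpos : ∀ᵐ p, p ∈ S → 0 < F p)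
    {x₁ x₂ y₁ y₂ : ℝ} (hx : x₁ < x₂) (hy : y₁ < y₂) (hsub : Ioo x₁ x₂ ×ˢ Ioo y₁ y₂ ⊆ S) :
    ∫ p in S, F p ≠ 0 := by
  intro h0
  have hpos' : ∀ᵐ p ∂volume.restrict S, 0 < F p := (ae_restrict_iff' hS).2 hpos
  have hzero := (setIntegral_eq_zero_iff_of_nonneg_ae (hpos'.mono fun p hp => hp.le) hF).1 h0
  have hfalse : ∀ᵐ p ∂volume.restrict S, False := by
    filter_upwards [hpos', hzero] with p hp hp0
    exact hp.ne' hp0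
  have hnull : volume S = 0 := by
    simpa [ae_iff] using hfalse
  have hrect := measure_mono_null hsub hnull
  rw [Measure.volume_eq_prod, Measure.prod_prod, Real.volume_Ioo, Real.volume_Ioo] at hrect
  simp only [mul_eq_zero, ENNReal.ofReal_eq_zero] at hrect
  rcases hrect with h | h <;> linarith

/-- Young's inequality for continuous increasing functions (Corollary 1 of
Mitroi–Niculescu), together with the equality case under a.e. strict positivity of `K`. -/
theorem young_inequality_continuous_increasing (f g : ℝ → ℝ) (K : ℝ → ℝ → ℝ)
    (hf_mono : StrictMonoOn f (Set.Ici 0))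
    (hf_cont : ContinuousOn f (Set.Ici 0))
    (hf_nonneg : ∀ x, 0 ≤ x → 0 ≤ f x)
    (hf0 : f 0 = 0)
    (hf_tendsto : Filter.Tendsto f Filter.atTop Filter.atTop)
    (hg_left : ∀ x, 0 ≤ x → g (f x) = x)
    (hg_right : ∀ y, 0 ≤ y → f (g y) = y)
    (hg_nonneg : ∀ y, 0 ≤ y → 0 ≤ g y)
    (hK_nonneg : ∀ x y, 0 ≤ x → 0 ≤ y → 0 ≤ K x y)
    (hK_loc : MeasureTheory.LocallyIntegrableOn (fun p : ℝ × ℝ => K p.1 p.2)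
      (Set.Ici (0:ℝ) ×ˢ Set.Ici (0:ℝ)))
    (a b c : ℝ) (ha : 0 ≤ a) (hab : a < b) (hc : f a ≤ c) :
    ((∫ x in a..b, ∫ y in f a..c, K x y) ≤
      (∫ x in a..b, ∫ y in f a..f x, K x y) +
        ∫ y in f a..c, ∫ x in a..g y, K x y) ∧
    ((∀ᵐ p : ℝ × ℝ, p ∈ Set.Ici (0:ℝ) ×ˢ Set.Ici (0:ℝ) → 0 < K p.1 p.2) →
      ((∫ x in a..b, ∫ y in f a..c, K x y) =
        (∫ x in a..b, ∫ y in f a..f x, K x y) +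
          (∫ y in f a..c, ∫ x in a..g y, K x y) ↔ c = f b)) := by
  set F : ℝ × ℝ → ℝ := fun p => K p.1 p.2 with hF
  have hfa : 0 ≤ f a := hf_nonneg a ha
  have hc0 : 0 ≤ c := hfa.trans hc
  have hb0 : 0 ≤ b := ha.trans hab.le
  have galois : ∀ x y, 0 ≤ x → 0 ≤ y → (f x ≤ y ↔ x ≤ g y) := fun x y hx hy => by
    rw [← hf_mono.le_iff_le (mem_Ici.2 hx) (mem_Ici.2 (hg_nonneg y hy)), hg_right y hy]
  have hgc : a ≤ g c := (galois a c ha hc0).1 hc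
  set φ : ℝ → ℝ := fun x => f (max x 0) with hφ_def
  have hφ : Measurable φ := by
    refine Monotone.measurable fun x y hxy => ?_
    exact hf_mono.monotoneOn (mem_Ici.2 (le_max_right _ _)) (mem_Ici.2 (le_max_right _ _))
      (max_le_max hxy le_rfl)
  have hφ_eq : ∀ x, 0 ≤ x → φ x = f x := fun x hx => by simp [hφ_def, hx]
  set S₀ : Set (ℝ × ℝ) := {p | p.1 ∈ Ioc a b ∧ p.2 ∈ Ioc (f a) c} with hS₀
  set S₁ : Set (ℝ × ℝ) := {p | p.1 ∈ Ioc a b ∧ p.2 ∈ Ioc (f a) (f p.1)} with hS₁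
  set S₂ : Set (ℝ × ℝ) := {p | p.2 ∈ Ioc (f a) c ∧ p.1 ∈ Ioc a (g p.2)} with hS₂
  have mS₀ : MeasurableSet S₀ :=
    (measurable_fst measurableSet_Ioc).inter (measurable_snd measurableSet_Ioc)
  have mS₁ : MeasurableSet S₁ := by
    have h : S₁ = (Prod.fst ⁻¹' Ioc a b ∩ Prod.snd ⁻¹' Ioi (f a)) ∩ {p | p.2 ≤ φ p.1} := by
      ext p
      simp only [hS₁, mem_ofPred_eq, mem_inter_iff, mem_preimage, mem_Ioc, mem_Ioi]
      constructor
      · rintro ⟨h1, h2, h3⟩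
        exact ⟨⟨h1, h2⟩, by rwa [hφ_eq _ (ha.trans h1.1.le)]⟩
      · rintro ⟨⟨h1, h2⟩, h3⟩
        exact ⟨h1, h2, by rwa [hφ_eq _ (ha.trans h1.1.le)] at h3⟩
    rw [h]
    exact ((measurable_fst measurableSet_Ioc).inter (measurable_snd measurableSet_Ioi)).inter
      (measurableSet_le measurable_snd (hφ.comp measurable_fst))
  have mS₂ : MeasurableSet S₂ := by
    have h : S₂ = (Prod.snd ⁻¹' Ioc (f a) c ∩ Prod.fst ⁻¹' Ioi a) ∩ {p | φ p.1 ≤ p.2} := by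
      ext p
      simp only [hS₂, mem_ofPred_eq, mem_inter_iff, mem_preimage, mem_Ioc, mem_Ioi]
      constructor
      · rintro ⟨h1, h2, h3⟩
        refine ⟨⟨h1, h2⟩, ?_⟩
        rw [hφ_eq _ (ha.trans h2.le)]
        exact (galois _ _ (ha.trans h2.le) (hfa.trans h1.1.le)).2 h3
      · rintro ⟨⟨h1, h2⟩, h3⟩
        rw [hφ_eq _ (ha.trans h2.le)] at h3
        exact ⟨h1, h2, (galois _ _ (ha.trans h2.le) (hfa.trans h1.1.le)).1 h3⟩
    rw [h]
    exact ((measurable_snd measurableSet_Ioc).inter (measurable_fst measurableSet_Ioi)).inter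
      (measurableSet_le (hφ.comp measurable_fst) measurable_snd)
  have hbox : ∀ M N : ℝ, IntegrableOn F (Icc 0 M ×ˢ Icc 0 N) := fun M N =>
    hK_loc.integrableOn_compact_subset (prod_mono Icc_subset_Ici_self Icc_subset_Ici_self)
      (isCompact_Icc.prod isCompact_Icc)
  have iS₀ : IntegrableOn F S₀ := (hbox b c).mono_set fun p hp =>
    ⟨⟨ha.trans hp.1.1.le, hp.1.2⟩, hfa.trans hp.2.1.le, hp.2.2⟩
  have iS₁ : IntegrableOn F S₁ := (hbox b (f b)).mono_set fun p hp =>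
    ⟨⟨ha.trans hp.1.1.le, hp.1.2⟩, hfa.trans hp.2.1.le, hp.2.2.trans
      (hf_mono.monotoneOn (mem_Ici.2 (ha.trans hp.1.1.le)) (mem_Ici.2 hb0) hp.1.2)⟩
  have iS₂ : IntegrableOn F S₂ := (hbox (g c) c).mono_set fun p hp => by
    have hp1 := ha.trans hp.2.1.le
    have hp2 := hfa.trans hp.1.1.le
    exact ⟨⟨hp1, (galois _ _ hp1 hc0).1 (((galois _ _ hp1 hp2).2 hp.2.2).trans hp.1.2)⟩,
      hp2, hp.1.2⟩
  have e₀ : ∫ x in a..b, ∫ y in f a..c, K x y = ∫ p in S₀, F p := by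
    refine Eq.trans ?_ (setIntegral_region_eq (B := fun _ => Ioc (f a) c)
      measurableSet_Ioc mS₀ iS₀).symm
    simp only [integral_of_le hab.le, integral_of_le hc, hF]
  have e₁ : ∫ x in a..b, ∫ y in f a..f x, K x y = ∫ p in S₁, F p := by
    refine Eq.trans ?_ (setIntegral_region_eq (B := fun x => Ioc (f a) (f x))
      measurableSet_Ioc mS₁ iS₁).symm
    rw [integral_of_le hab.le]
    refine setIntegral_congr_fun measurableSet_Ioc fun x hx => ?_
    exact integral_of_le (hf_mono.monotoneOn (mem_Ici.2 ha) (mem_Ici.2 (ha.trans hx.1.le)) hx.1.le)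
  have e₂ : ∫ y in f a..c, ∫ x in a..g y, K x y = ∫ p in S₂, F p := by
    refine Eq.trans ?_ (setIntegral_region_eq_symm (B := fun y => Ioc a (g y))
      measurableSet_Ioc mS₂ iS₂).symm
    rw [integral_of_le hc]
    refine setIntegral_congr_fun measurableSet_Ioc fun y hy => ?_
    exact integral_of_le ((galois a y ha (hfa.trans hy.1.le)).1 hy.1.le)
  have hdisj : AEDisjoint volume S₁ S₂ := by
    refine measure_mono_null (fun p hp => ?_) (volume_graph_eq_zero hφ)
    obtain ⟨⟨h1, h2⟩, h3, h4⟩ := hp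
    have hp1 := ha.trans h1.1.le
    rw [mem_ofPred_eq, hφ_eq _ hp1]
    exact le_antisymm h2.2 ((galois _ _ hp1 (hfa.trans h2.1.le)).2 h4.2)
  have hsub : S₀ ⊆ S₁ ∪ S₂ := by
    rintro p ⟨h1, h2⟩
    rcases le_total p.2 (f p.1) with h | h
    · exact Or.inl ⟨h1, h2.1, h⟩
    · exact Or.inr ⟨h2, h1.1, (galois _ _ (ha.trans h1.1.le) (hfa.trans h2.1.le)).1 h⟩
  have hquad : S₁ ∪ S₂ ⊆ Ici 0 ×ˢ Ici 0 := by
    rintro p (⟨h1, h2⟩ | ⟨h2, h1⟩) <;> exact ⟨ha.trans h1.1.le, hfa.trans h2.1.le⟩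
  have iU : IntegrableOn F (S₁ ∪ S₂) := iS₁.union iS₂
  have mD : MeasurableSet ((S₁ ∪ S₂) \ S₀) := (mS₁.union mS₂).diff mS₀
  have hdecomp : (∫ p in S₁, F p) + ∫ p in S₂, F p =
      (∫ p in S₀, F p) + ∫ p in (S₁ ∪ S₂) \ S₀, F p := by
    rw [← setIntegral_union₀ hdisj mS₂.nullMeasurableSet iS₁ iS₂,
      setIntegral_sdiff mS₀ iU hsub]
    ring
  rw [e₀, e₁, e₂, hdecomp]
  refine ⟨le_add_of_nonneg_right (setIntegral_nonneg mD fun p hp =>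
    hK_nonneg _ _ (hquad hp.1).1 (hquad hp.1).2), fun hpos => ?_⟩
  rw [left_eq_add]
  constructor
  · intro h0
    by_contra hne
    have hposD : ∀ᵐ p, p ∈ (S₁ ∪ S₂) \ S₀ → 0 < F p := by
      filter_upwards [hpos] with p hp hpD using hp (hquad hpD.1)
    have iD := iU.mono_set (sdiff_subset (t := S₀))
    rcases lt_or_gt_of_ne hne with hlt | hlt
    · have hgb : g c < b := by
        rw [← not_le, ← galois b c hb0 hc0]
        exact not_le.2 hlt
      obtain ⟨x₀, hx₀, hx₀b⟩ := exists_between hgb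
      have hx₀0 : 0 ≤ x₀ := (hg_nonneg c hc0).trans hx₀.le
      have hcx : c < f x₀ := by
        rw [← not_le, galois x₀ c hx₀0 hc0]
        exact not_le.2 hx₀
      refine setIntegral_ne_zero_of_rectangle_subset mD iD hposD hx₀b hcx ?_ h0
      rintro p ⟨hp1, hp2⟩
      refine ⟨Or.inl ⟨⟨hgc.trans_lt (hx₀.trans hp1.1), hp1.2.le⟩, hc.trans_lt hp2.1, ?_⟩,
        fun h => hp2.1.not_ge h.2.2⟩
      exact hp2.2.le.trans
        (hf_mono.monotoneOn (mem_Ici.2 hx₀0) (mem_Ici.2 (hx₀0.trans hp1.1.le)) hp1.1.le)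
    · obtain ⟨y₀, hy₀, hy₀c⟩ := exists_between hlt
      have hfab : f a ≤ f b := hf_mono.monotoneOn (mem_Ici.2 ha) (mem_Ici.2 hb0) hab.le
      have hy₀0 : 0 ≤ y₀ := hfa.trans (hfab.trans hy₀.le)
      have hbg : b < g y₀ := by
        rw [← hf_mono.lt_iff_lt (mem_Ici.2 hb0) (mem_Ici.2 (hg_nonneg y₀ hy₀0)),
          hg_right y₀ hy₀0]
        exact hy₀
      refine setIntegral_ne_zero_of_rectangle_subset mD iD hposD hbg hy₀c ?_ h0
      rintro p ⟨hp1, hp2⟩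
      refine ⟨Or.inr ⟨⟨hfab.trans_lt (hy₀.trans hp2.1), hp2.2.le⟩, hab.trans hp1.1, ?_⟩,
        fun h => hp1.1.not_ge h.1.2⟩
      have hp0 := hb0.trans hp1.1.le
      refine (galois _ _ hp0 (hy₀0.trans hp2.1.le)).1
        (((galois _ _ hp0 hy₀0).2 hp1.2.le).trans hp2.1.le)
  · intro hcb
    have hempty : (S₁ ∪ S₂) \ S₀ = ∅ := by
      rw [sdiff_eq_empty]
      rintro p (⟨h1, h2⟩ | ⟨h2, h1⟩)
      · exact ⟨h1, h2.1, hcb ▸ h2.2.trans (hf_mono.monotoneOn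
          (mem_Ici.2 (ha.trans h1.1.le)) (mem_Ici.2 hb0) h1.2)⟩
      · have hp1 := ha.trans h1.1.le
        refine ⟨⟨h1.1, ?_⟩, h2⟩
        rw [← hf_mono.le_iff_le (mem_Ici.2 hp1) (mem_Ici.2 hb0), ← hcb]
        exact ((galois _ _ hp1 (hfa.trans h2.1.le)).2 h1.2).trans h2.2
    simp [hempty]
end

section
/- (Young's inequality without strict monotonicity.) Let f : [0,∞) → [0,∞) be nondecreasing with f(0) = 0 and lim_{x→∞} f(x) = ∞, and let f_sup⁻¹(y) = inf{x ≥ 0 : f(x) > y} be its pseudo-inverse. Then for all nonnegative real numbers a and b, ab ≤ ∫_0^a f(x) dx + ∫_0^b f_sup⁻¹(y) dy. -/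
open MeasureTheory Set Filter intervalIntegral

/-- The rectangle `(0, a) × (0, b)` is covered by the region below `f` together with the reflection
of the region below `g`, so its area is at most the sum of the two integrals. -/
theorem mul_le_integral_add_integral_of_forall_lt_or_lt {f g : ℝ → ℝ} {a b : ℝ}
    (ha : 0 ≤ a) (hb : 0 ≤ b)
    (hf : IntervalIntegrable f volume 0 a) (hg : IntervalIntegrable g volume 0 b)
    (hf_nonneg : ∀ x ∈ Ioo 0 a, 0 ≤ f x) (hg_nonneg : ∀ y ∈ Ioo 0 b, 0 ≤ g y)
    (h : ∀ x ∈ Ioo 0 a, ∀ y ∈ Ioo 0 b, y < f x ∨ x < g y) :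
    a * b ≤ (∫ x in (0:ℝ)..a, f x) + ∫ y in (0:ℝ)..b, g y := by
  have region_volume : ∀ {u : ℝ → ℝ} {c : ℝ}, 0 ≤ c → IntervalIntegrable u volume 0 c →
      (∀ x ∈ Ioo 0 c, 0 ≤ u x) →
      volume (regionBetween 0 u (Ioo 0 c)) = ENNReal.ofReal (∫ x in (0:ℝ)..c, u x) := by
    intro u c hc hu hu_nonneg
    rw [Measure.volume_eq_prod, volume_regionBetween_eq_integral (f := 0) integrableOn_zero
      ((intervalIntegrable_iff_integrableOn_Ioo_of_le hc).1 hu) measurableSet_Ioo hu_nonneg,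
      intervalIntegral.integral_of_le hc, integral_Ioc_eq_integral_Ioo]
    simp
  have interval_nonneg : ∀ {u : ℝ → ℝ} {c : ℝ}, 0 ≤ c → (∀ x ∈ Ioo 0 c, 0 ≤ u x) →
      0 ≤ ∫ x in (0:ℝ)..c, u x := by
    intro u c hc hu
    rw [intervalIntegral.integral_of_le hc, integral_Ioc_eq_integral_Ioo]
    exact setIntegral_nonneg measurableSet_Ioo hu
  have hcover : Ioo 0 a ×ˢ Ioo 0 b ⊆
      regionBetween 0 f (Ioo 0 a) ∪ MeasurableEquiv.prodComm ⁻¹' regionBetween 0 g (Ioo 0 b) := by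
    rintro ⟨x, y⟩ ⟨hx, hy⟩
    rcases h x hx y hy with hxy | hxy
    · exact Or.inl ⟨hx, hy.1, hxy⟩
    · exact Or.inr ⟨hy, hx.1, hxy⟩
  have hswap : MeasurePreserving (MeasurableEquiv.prodComm : ℝ × ℝ ≃ᵐ ℝ × ℝ) volume volume :=
    Measure.measurePreserving_swap
  have hvol := (measure_mono (μ := volume) hcover).trans (measure_union_le _ _)
  rw [hswap.measure_preimage_equiv, region_volume ha hf hf_nonneg,
    region_volume hb hg hg_nonneg, Measure.volume_eq_prod, Measure.prod_prod, Real.volume_Ioo,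
    Real.volume_Ioo, sub_zero, sub_zero, ← ENNReal.ofReal_mul ha,
    ← ENNReal.ofReal_add (interval_nonneg ha hf_nonneg) (interval_nonneg hb hg_nonneg)] at hvol
  exact (ENNReal.ofReal_le_ofReal_iff
    (add_nonneg (interval_nonneg ha hf_nonneg) (interval_nonneg hb hg_nonneg))).1 hvol

/-- Young's inequality without strict monotonicity: for a nondecreasing `f` with
`f 0 = 0`, `f x → ∞`, and pseudo-inverse `finv y = inf {x ≥ 0 : f x > y}`,
`ab ≤ ∫_0^a f + ∫_0^b finv`. -/
theorem young_inequality_pseudo_inverse (f finv : ℝ → ℝ)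
    (hf_mono : MonotoneOn f (Set.Ici 0))
    (hf_nonneg : ∀ x, 0 ≤ x → 0 ≤ f x)
    (hf0 : f 0 = 0)
    (hf_tendsto : Filter.Tendsto f Filter.atTop Filter.atTop)
    (hfinv : ∀ y, finv y = sInf {x : ℝ | 0 ≤ x ∧ y < f x})
    (a b : ℝ) (ha : 0 ≤ a) (hb : 0 ≤ b) :
    a * b ≤ (∫ x in (0:ℝ)..a, f x) + ∫ y in (0:ℝ)..b, finv y := by
  have hne : ∀ y, {x : ℝ | 0 ≤ x ∧ y < f x}.Nonempty := fun y ↦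
    ((eventually_ge_atTop 0).and (hf_tendsto.eventually_gt_atTop y)).exists
  have hfinv_nonneg : ∀ y, 0 ≤ finv y := fun y ↦ hfinv y ▸ Real.sInf_nonneg fun _ hx ↦ hx.1
  have hfinv_mono : Monotone finv := fun y z hyz ↦ by
    rw [hfinv y, hfinv z]
    exact csInf_le_csInf ⟨0, fun _ hx ↦ hx.1⟩ (hne z) fun _ hx ↦ ⟨hx.1, hyz.trans_lt hx.2⟩
  have hf_int : IntervalIntegrable f volume 0 a :=
    (hf_mono.mono (by rw [uIcc_of_le ha]; exact Icc_subset_Ici_self)).intervalIntegrable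
  have hfinv_int : IntervalIntegrable finv volume 0 b := hfinv_mono.intervalIntegrable
  have hle : ∀ x, 0 ≤ x → ∀ y, f x ≤ y → x ≤ finv y := fun x hx y hxy ↦ by
    rw [hfinv]
    exact le_csInf (hne y) fun z hz ↦ (hf_mono.reflect_lt hx hz.1 (hxy.trans_lt hz.2)).le
  -- The strict inequality required by the covering lemma is obtained by perturbing `finv`.
  have hperturb : ∀ ε > 0,
      a * b ≤ (∫ x in (0:ℝ)..a, f x) + (∫ y in (0:ℝ)..b, finv y) + b * ε := fun ε hε ↦ by
    have := mul_le_integral_add_integral_of_forall_lt_or_lt ha hb hf_int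
      (hfinv_int.add (intervalIntegrable_const (c := ε)))
      (fun x hx ↦ hf_nonneg x hx.1.le) (fun y _ ↦ add_nonneg (hfinv_nonneg y) hε.le)
      fun x hx y _ ↦ (lt_or_ge y (f x)).imp_right fun hxy ↦
        (hle x hx.1.le y hxy).trans_lt (lt_add_of_pos_right _ hε)
    rw [intervalIntegral.integral_add hfinv_int intervalIntegrable_const,
      intervalIntegral.integral_const, sub_zero, smul_eq_mul] at this
    linarith
  have hlim : Tendsto
      (fun ε ↦ (∫ x in (0:ℝ)..a, f x) + (∫ y in (0:ℝ)..b, finv y) + b * ε)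
      (nhdsWithin 0 (Ioi 0)) (nhds ((∫ x in (0:ℝ)..a, f x) + ∫ y in (0:ℝ)..b, finv y)) := by
    refine Tendsto.mono_left (Continuous.tendsto' (by fun_prop) _ _ (by simp)) nhdsWithin_le_nhds
  exact ge_of_tendsto hlim (eventually_mem_nhdsWithin.mono hperturb)
end

section
/- (Gaussian companion of Young's inequality.) Let erf(x) = (2/√π) ∫_0^x e^{−s²} ds denote the Gauss error function, and let p, q > 1 satisfy 1/p + 1/q = 1. Then for all x, y ≥ 0, erf(x)·erf(y) ≤ (2/√π) ∫_0^x erf(s^{p−1}) e^{−s²} ds + (2/√π) ∫_0^y erf(t^{q−1}) e^{−t²} dt. -/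
open MeasureTheory Set Filter intervalIntegral

/-- Equality case of Young's inequality for the measure with density `f`: the two regions cut out
by the graph of `φ` fill the rectangle with corner `(a, φ a)`. -/
theorem integral_comp_add_integral_comp_inverse {F f φ ψ : ℝ → ℝ} (hf : Continuous f)
    (hF : ∀ u, HasDerivAt F (f u) u) (hF0 : F 0 = 0) (hφ : Continuous φ) (hψ : Continuous ψ)
    (hφ0 : φ 0 = 0) (hφd : ∀ u, 0 < u → DifferentiableAt ℝ φ u)
    (hinv : ∀ u, 0 ≤ u → ψ (φ u) = u) {a : ℝ} (ha : 0 ≤ a) :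
    (∫ s in (0:ℝ)..a, F (φ s) * f s) + ∫ t in (0:ℝ)..φ a, F (ψ t) * f t = F a * F (φ a) := by
  have hFc : Continuous F := continuous_iff_continuousAt.2 fun u => (hF u).continuousAt
  have c1 : Continuous fun s => F (φ s) * f s := by fun_prop
  have c2 : Continuous fun t => F (ψ t) * f t := by fun_prop
  have d1 : ∀ u, HasDerivAt (fun u => ∫ s in (0:ℝ)..u, F (φ s) * f s) (F (φ u) * f u) u :=
    fun u => c1.integral_hasStrictDerivAt 0 u |>.hasDerivAt
  have d2 : ∀ u, HasDerivAt (fun u => ∫ t in (0:ℝ)..u, F (ψ t) * f t) (F (ψ u) * f u) u :=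
    fun u => c2.integral_hasStrictDerivAt 0 u |>.hasDerivAt
  have k1 : Continuous fun u => ∫ s in (0:ℝ)..u, F (φ s) * f s :=
    continuous_iff_continuousAt.2 fun u => (d1 u).continuousAt
  have k2 : Continuous fun u => ∫ t in (0:ℝ)..u, F (ψ t) * f t :=
    continuous_iff_continuousAt.2 fun u => (d2 u).continuousAt
  let G : ℝ → ℝ := fun u => (∫ s in (0:ℝ)..u, F (φ s) * f s) +
    (∫ t in (0:ℝ)..φ u, F (ψ t) * f t) - F u * F (φ u)
  have hGc : Continuous G := (k1.add (k2.comp hφ)).sub (hFc.mul (hFc.comp hφ))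
  have hGd : ∀ u ∈ interior (Ici (0:ℝ)), HasDerivAt G 0 u := by
    intro u hu
    rw [interior_Ici] at hu
    have hφ' := (hφd u hu).hasDerivAt
    have h := ((d1 u).add ((d2 (φ u)).comp u hφ')).sub ((hF u).mul ((hF (φ u)).comp u hφ'))
    refine h.congr_deriv ?_
    simp only [hinv u (mem_Ioi.1 hu).le, Function.comp_apply]
    ring
  have hdiff : DifferentiableOn ℝ G (interior (Ici (0:ℝ))) :=
    fun u hu => (hGd u hu).differentiableAt.differentiableWithinAt
  have hmono : MonotoneOn G (Ici 0) := monotoneOn_of_deriv_nonneg (convex_Ici 0) hGc.continuousOn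
    hdiff fun u hu => (hGd u hu).deriv.ge
  have hanti : AntitoneOn G (Ici 0) := antitoneOn_of_deriv_nonpos (convex_Ici 0) hGc.continuousOn
    hdiff fun u hu => (hGd u hu).deriv.le
  have hG : G a = G 0 :=
    le_antisymm (hanti self_mem_Ici ha ha) (hmono self_mem_Ici ha ha)
  have hG0 : G 0 = 0 := by simp [G, hφ0, hF0]
  exact sub_eq_zero.1 (hG.trans hG0)

/-- Young's inequality for the measure with nonnegative density `f` and antiderivative `F`. -/
theorem mul_le_integral_comp_add_integral_comp_inverse {F f φ ψ : ℝ → ℝ} (hf : Continuous f)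
    (hf0 : ∀ u, 0 ≤ f u) (hF : ∀ u, HasDerivAt F (f u) u) (hF0 : F 0 = 0) (hφ : Continuous φ)
    (hψ : Continuous ψ) (hφ0 : φ 0 = 0) (hφd : ∀ u, 0 < u → DifferentiableAt ℝ φ u)
    (hφm : MonotoneOn φ (Ici 0)) (hψ0 : ∀ u, 0 ≤ u → 0 ≤ ψ u)
    (hinv : ∀ u, 0 ≤ u → ψ (φ u) = u) (hinv' : ∀ u, 0 ≤ u → φ (ψ u) = u)
    {x y : ℝ} (hx : 0 ≤ x) (hy : 0 ≤ y) :
    F x * F y ≤ (∫ s in (0:ℝ)..x, F (φ s) * f s) + ∫ t in (0:ℝ)..y, F (ψ t) * f t := by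
  have hFc : Continuous F := continuous_iff_continuousAt.2 fun u => (hF u).continuousAt
  have hFm : Monotone F := monotone_of_hasDerivAt_nonneg hF hf0
  have hz := hψ0 y hy
  have heq := integral_comp_add_integral_comp_inverse hf hF hF0 hφ hψ hφ0 hφd hinv hz
  rw [hinv' y hy] at heq
  have c1 : Continuous fun s => F (φ s) * f s := by fun_prop
  have hsplit := intervalIntegral.integral_add_adjacent_intervals
    (c1.intervalIntegrable (μ := volume) 0 (ψ y)) (c1.intervalIntegrable (ψ y) x)
  have hftc : ∫ s in (ψ y)..x, F y * f s = F y * (F x - F (ψ y)) := by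
    rw [intervalIntegral.integral_const_mul, intervalIntegral.integral_eq_sub_of_hasDerivAt
      (fun u _ => hF u) (hf.intervalIntegrable _ _)]
  have key : ∫ s in (ψ y)..x, F y * f s ≤ ∫ s in (ψ y)..x, F (φ s) * f s := by
    have c2 : Continuous fun s => F y * f s := by fun_prop
    rcases le_total (ψ y) x with h | h
    · refine intervalIntegral.integral_mono_on h (c2.intervalIntegrable _ _)
        (c1.intervalIntegrable _ _) fun s hs => mul_le_mul_of_nonneg_right (hFm ?_) (hf0 s)
      simpa [hinv' y hy] using hφm hz (hz.trans hs.1) hs.1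
    · rw [intervalIntegral.integral_symm x, intervalIntegral.integral_symm x (ψ y), neg_le_neg_iff]
      refine intervalIntegral.integral_mono_on h (c1.intervalIntegrable _ _)
        (c2.intervalIntegrable _ _) fun s hs => mul_le_mul_of_nonneg_right (hFm ?_) (hf0 s)
      simpa [hinv' y hy] using hφm (hx.trans hs.1) hz hs.2
  rw [hftc] at key
  linarith

/-- Gaussian companion of Young's inequality:
`erf x * erf y ≤ (2/√π) ∫_0^x erf (s^(p-1)) e^(-s²) ds + (2/√π) ∫_0^y erf (t^(q-1)) e^(-t²) dt`
for conjugate exponents `p, q > 1`. -/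
theorem young_inequality_gaussian (erf : ℝ → ℝ)
    (herf : ∀ u, erf u = (2 / Real.sqrt Real.pi) * ∫ s in (0:ℝ)..u, Real.exp (-s ^ 2))
    (p q : ℝ) (hp : 1 < p) (hq : 1 < q) (hpq : 1 / p + 1 / q = 1)
    (x y : ℝ) (hx : 0 ≤ x) (hy : 0 ≤ y) :
    erf x * erf y ≤
      (2 / Real.sqrt Real.pi) * (∫ s in (0:ℝ)..x, erf (s ^ (p - 1)) * Real.exp (-s ^ 2)) +
        (2 / Real.sqrt Real.pi) * ∫ t in (0:ℝ)..y, erf (t ^ (q - 1)) * Real.exp (-t ^ 2) := by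
  have hc : Continuous fun s : ℝ => Real.exp (-s ^ 2) := by fun_prop
  have hF : ∀ u, HasDerivAt erf (2 / Real.sqrt Real.pi * Real.exp (-u ^ 2)) u := by
    intro u
    rw [funext herf]
    exact (hc.integral_hasStrictDerivAt 0 u).hasDerivAt.const_mul _
  have hmul : (p - 1) * (q - 1) = 1 := by
    field_simp at hpq
    linarith
  have hp' : 0 < p - 1 := by linarith
  have hq' : 0 < q - 1 := by linarith
  have h := mul_le_integral_comp_add_integral_comp_inverse (φ := fun s => s ^ (p - 1))
    (ψ := fun t => t ^ (q - 1)) (by fun_prop) (fun u => by positivity) hF (by simp [herf])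
    (Real.continuous_rpow_const hp'.le) (Real.continuous_rpow_const hq'.le)
    (Real.zero_rpow hp'.ne')
    (fun u hu => (Real.hasDerivAt_rpow_const (Or.inl hu.ne')).differentiableAt)
    (fun u hu v _ huv => Real.rpow_le_rpow hu huv hp'.le) (fun u hu => Real.rpow_nonneg hu _)
    (fun u hu => by rw [← Real.rpow_mul hu, hmul, Real.rpow_one])
    (fun u hu => by rw [← Real.rpow_mul hu, mul_comm, hmul, Real.rpow_one]) hx hy
  simpa only [← intervalIntegral.integral_const_mul, mul_left_comm] using h
end

section
/- Let f : [0,∞) → [0,∞) be a continuous nondecreasing function with f(0) = 0 and lim_{x→∞} f(x) = ∞, with pseudo-inverse f_sup⁻¹(y) = inf{x ≥ 0 : f(x) > y}, and let p > 1. Then for all b, c ≥ 0, ∫_0^b f(x)^p dx + ∫_0^c (f_sup⁻¹(y))^p dy ≥ p·b·c − (p − 1)(b + c). -/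
open MeasureTheory Set Filter intervalIntegral

/-- Bernoulli's inequality, written as a tangent line bound for `a ↦ a ^ p` at `1`. -/
lemma mul_sub_le_rpow {a p : ℝ} (ha : 0 ≤ a) (hp : 1 ≤ p) : p * a - (p - 1) ≤ a ^ p := by
  have h := one_add_mul_self_le_rpow_one_add (s := a - 1) (by linarith) hp
  rw [add_sub_cancel] at h
  linarith

/-- Integrated form of the tangent line bound for `a ↦ a ^ p` at `1`. -/
lemma mul_integral_sub_le_integral_rpow {g : ℝ → ℝ} {p b : ℝ} (hp : 1 ≤ p) (hb : 0 ≤ b)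
    (hg : MonotoneOn g (Ici 0)) (hg_nonneg : ∀ x, 0 ≤ x → 0 ≤ g x) :
    p * (∫ x in (0 : ℝ)..b, g x) - (p - 1) * b ≤ ∫ x in (0 : ℝ)..b, g x ^ p := by
  have hsub : uIcc 0 b ⊆ Ici 0 := by
    rw [uIcc_of_le hb]
    exact Icc_subset_Ici_self
  have hgi : IntervalIntegrable g volume 0 b := (hg.mono hsub).intervalIntegrable
  have hgpi : IntervalIntegrable (fun x ↦ g x ^ p) volume 0 b := by
    refine MonotoneOn.intervalIntegrable fun x hx y hy hxy ↦ ?_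
    exact Real.rpow_le_rpow (hg_nonneg x (hsub hx)) (hg (hsub hx) (hsub hy) hxy) (by linarith)
  have h := integral_mono_on hb ((hgi.const_mul p).sub intervalIntegrable_const) hgpi
    fun x hx ↦ mul_sub_le_rpow (hg_nonneg x hx.1) hp
  rw [intervalIntegral.integral_sub (hgi.const_mul p) intervalIntegrable_const,
    intervalIntegral.integral_const_mul, intervalIntegral.integral_const, smul_eq_mul] at h
  linarith

/-- The subgraph of `g` over `(0, b)` has area `∫ x in 0..b, g x`. -/
lemma volume_regionBetween_zero {g : ℝ → ℝ} {b : ℝ} (hb : 0 ≤ b)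
    (hg : IntervalIntegrable g volume 0 b) (hg_nonneg : ∀ x, 0 ≤ x → 0 ≤ g x) :
    volume (regionBetween (fun _ ↦ 0) g (Ioo 0 b)) =
      ENNReal.ofReal (∫ x in (0 : ℝ)..b, g x) := by
  have hgi : IntegrableOn g (Ioo 0 b) :=
    (intervalIntegrable_iff_integrableOn_Ioo_of_le hb).1 hg
  rw [Measure.volume_eq_prod, volume_regionBetween_eq_integral integrableOn_zero hgi
    measurableSet_Ioo fun x hx ↦ hg_nonneg x hx.1.le, integral_of_le hb,
    integral_Ioc_eq_integral_Ioo]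
  simp

/-- Young's integral inequality for functions `f`, `g` such that at every point `(x, y)` of the
positive quadrant either `y < f x` or `x ≤ g y`. -/
lemma mul_le_integral_add_integral {f g : ℝ → ℝ} {b c : ℝ} (hb : 0 ≤ b) (hc : 0 ≤ c)
    (hf : IntervalIntegrable f volume 0 b) (hf_nonneg : ∀ x, 0 ≤ x → 0 ≤ f x)
    (hg : IntervalIntegrable g volume 0 c) (hg_nonneg : ∀ y, 0 ≤ y → 0 ≤ g y)
    (h : ∀ x y, 0 < x → 0 < y → y < f x ∨ x ≤ g y) :
    b * c ≤ (∫ x in (0 : ℝ)..b, f x) + ∫ y in (0 : ℝ)..c, g y := by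
  have key : ∀ ε > 0, b * c ≤ (∫ x in (0 : ℝ)..b, f x) + (∫ y in (0 : ℝ)..c, g y) + c * ε := by
    intro ε hε
    have hgε : IntervalIntegrable (fun y ↦ g y + ε) volume 0 c := hg.add intervalIntegrable_const
    have hgε_nonneg : ∀ y, 0 ≤ y → 0 ≤ g y + ε := fun y hy ↦ by linarith [hg_nonneg y hy]
    have hsub : Ioo 0 b ×ˢ Ioo 0 c ⊆ regionBetween (fun _ ↦ 0) f (Ioo 0 b) ∪
        Prod.swap ⁻¹' regionBetween (fun _ ↦ 0) (fun y ↦ g y + ε) (Ioo 0 c) := by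
      rintro ⟨x, y⟩ ⟨hx, hy⟩
      rcases h x y hx.1 hy.1 with h | h
      · exact Or.inl ⟨hx, hy.1, h⟩
      · exact Or.inr ⟨hy, hx.1, by simpa using h.trans_lt (lt_add_of_pos_right _ hε)⟩
    have hswap : volume (Prod.swap ⁻¹' regionBetween (fun _ ↦ 0) (fun y ↦ g y + ε) (Ioo 0 c)) =
        volume (regionBetween (fun _ ↦ 0) (fun y ↦ g y + ε) (Ioo 0 c)) :=
      (Measure.measurePreserving_swap (μ := (volume : Measure ℝ))
        (ν := (volume : Measure ℝ))).measure_preimage_equiv (f := MeasurableEquiv.prodComm) _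
    have hvol := (measure_mono (μ := volume) hsub).trans (measure_union_le _ _)
    rw [hswap, volume_regionBetween_zero hb hf hf_nonneg,
      volume_regionBetween_zero hc hgε hgε_nonneg, Measure.volume_eq_prod, Measure.prod_prod,
      Real.volume_Ioo, Real.volume_Ioo, sub_zero, sub_zero, ← ENNReal.ofReal_mul hb,
      ← ENNReal.ofReal_add (integral_nonneg hb fun x hx ↦ hf_nonneg x hx.1)
        (integral_nonneg hc fun y hy ↦ hgε_nonneg y hy.1),
      ENNReal.ofReal_le_ofReal_iff (add_nonneg (integral_nonneg hb fun x hx ↦ hf_nonneg x hx.1)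
        (integral_nonneg hc fun y hy ↦ hgε_nonneg y hy.1)),
      integral_add hg intervalIntegrable_const, intervalIntegral.integral_const,
      smul_eq_mul, sub_zero] at hvol
    linarith
  refine le_of_forall_pos_le_add fun δ hδ ↦ ?_
  have h1 := key (δ / (c + 1)) (by positivity)
  have h2 : c * (δ / (c + 1)) ≤ δ := by
    rw [mul_div_assoc', div_le_iff₀ (by positivity)]
    nlinarith
  linarith

/-- The Sulaiman-type consequence of Theorem 2:
`∫_0^b f^p + ∫_0^c (finv)^p ≥ pbc - (p-1)(b+c)` for `p > 1`. -/
theorem young_inequality_power (f finv : ℝ → ℝ)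
    (hf_mono : MonotoneOn f (Set.Ici 0))
    (hf_nonneg : ∀ x, 0 ≤ x → 0 ≤ f x)
    (hf0 : f 0 = 0)
    (hf_tendsto : Filter.Tendsto f Filter.atTop Filter.atTop)
    (hfinv : ∀ y, finv y = sInf {x : ℝ | 0 ≤ x ∧ y < f x})
    (hf_cont : ContinuousOn f (Set.Ici 0))
    (p : ℝ) (hp : 1 < p)
    (b c : ℝ) (hb : 0 ≤ b) (hc : 0 ≤ c) :
    (∫ x in (0:ℝ)..b, f x ^ p) + (∫ y in (0:ℝ)..c, finv y ^ p) ≥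
      p * b * c - (p - 1) * (b + c) := by
  have hne : ∀ y, {x : ℝ | 0 ≤ x ∧ y < f x}.Nonempty := fun y ↦
    ((eventually_ge_atTop 0).and (hf_tendsto.eventually_gt_atTop y)).exists
  have hfinv_nonneg : ∀ y, 0 ≤ y → 0 ≤ finv y := fun y _ ↦ by
    rw [hfinv]
    exact Real.sInf_nonneg fun x hx ↦ hx.1
  have hfinv_mono : MonotoneOn finv (Ici 0) := fun y _ z _ hyz ↦ by
    rw [hfinv, hfinv]
    exact csInf_le_csInf ⟨0, fun x hx ↦ hx.1⟩ (hne z) fun x hx ↦ ⟨hx.1, hyz.trans_lt hx.2⟩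
  have hcover : ∀ x y, 0 < x → 0 < y → y < f x ∨ x ≤ finv y := fun x y hx _ ↦ by
    refine or_iff_not_imp_left.2 fun hxy ↦ ?_
    rw [hfinv]
    refine le_csInf (hne y) fun z hz ↦ le_of_not_gt fun hzx ↦ hxy ?_
    exact hz.2.trans_le (hf_mono hz.1 hx.le hzx.le)
  have hint : ∀ {g : ℝ → ℝ} {a : ℝ}, 0 ≤ a → MonotoneOn g (Ici 0) →
      IntervalIntegrable g volume 0 a := fun ha hg ↦ by
    refine (hg.mono ?_).intervalIntegrable
    rw [uIcc_of_le ha]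
    exact Icc_subset_Ici_self
  have hyoung := mul_le_integral_add_integral hb hc (hint hb hf_mono) hf_nonneg
    (hint hc hfinv_mono) hfinv_nonneg hcover
  have h1 := mul_integral_sub_le_integral_rpow hp.le hb hf_mono hf_nonneg
  have h2 := mul_integral_sub_le_integral_rpow hp.le hc hfinv_mono hfinv_nonneg
  nlinarith [mul_le_mul_of_nonneg_left hyoung (zero_le_one.trans hp.le)]
end

section
/- (Minguzzi's inequality.) Let f : [0,∞) → [0,∞) be continuous and strictly increasing with f(0) = 0 and lim_{x→∞} f(x) = ∞. Then for all b ≥ a ≥ 0 and c ≥ f(a): ∫_a^b f(x) dx + ∫_{f(a)}^c f⁻¹(y) dy − bc + a·f(a) ≤ (f⁻¹(c) − b)·(c − f(b)). Equality occurs if and only if c = f(b). -/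
open MeasureTheory Set Filter intervalIntegral

theorem MonotoneOn.intervalIntegral_bounds {f : ℝ → ℝ} {s t : ℝ} (hst : s ≤ t)
    (hf : MonotoneOn f (Icc s t)) :
    (t - s) * f s ≤ (∫ x in s..t, f x) ∧ (∫ x in s..t, f x) ≤ (t - s) * f t := by
  have hi : IntervalIntegrable f volume s t :=
    MonotoneOn.intervalIntegrable (by rwa [uIcc_of_le hst])
  constructor
  · simpa using integral_mono_on (f := fun _ => f s) hst (by simp) hi
      fun x hx => hf (left_mem_Icc.2 hst) hx hx.1
  · simpa using integral_mono_on (g := fun _ => f t) hst hi (by simp)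
      fun x hx => hf hx (right_mem_Icc.2 hst) hx.2

/-- A function whose increments are bounded by `|t - s| * |f t - f s|` with `f` continuous
is constant. -/
theorem eq_of_abs_sub_le_mul_abs_sub {f F : ℝ → ℝ} {a d : ℝ} (had : a ≤ d)
    (hf : ContinuousOn f (Icc a d))
    (hF : ∀ s ∈ Icc a d, ∀ t ∈ Icc a d, |F t - F s| ≤ |t - s| * |f t - f s|) :
    F d = F a := by
  have hderiv : ∀ s ∈ Icc a d, HasDerivWithinAt F 0 (Icc a d) s := by
    intro s hs
    rw [hasDerivWithinAt_iff_isLittleO, Asymptotics.isLittleO_iff]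
    intro ε hε
    filter_upwards [self_mem_nhdsWithin, Metric.tendsto_nhds.1 (hf s hs) ε hε] with t ht hft
    rw [Real.dist_eq] at hft
    simp only [smul_zero, sub_zero, Real.norm_eq_abs]
    nlinarith [hF s hs t ht, abs_nonneg (t - s)]
  refine constant_of_has_deriv_right_zero (fun s hs => (hderiv s hs).continuousWithinAt)
    (fun s hs => ?_) d (right_mem_Icc.2 had)
  exact ((hderiv s (Ico_subset_Icc_self hs)).mono (Icc_subset_Icc_left hs.1)).mono_of_mem_nhdsWithin
    (Icc_mem_nhdsGE hs.2)

/-- Laisant's formula for the integral of an inverse function. -/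
theorem integral_add_integral_inverse {f g : ℝ → ℝ} {a d : ℝ} (had : a ≤ d)
    (hf : MonotoneOn f (Icc a d)) (hc : ContinuousOn f (Icc a d))
    (hg : MonotoneOn g (Icc (f a) (f d))) (hgf : ∀ x ∈ Icc a d, g (f x) = x) :
    (∫ x in a..d, f x) + (∫ y in f a..f d, g y) = d * f d - a * f a := by
  let F : ℝ → ℝ := fun t => (∫ x in a..t, f x) + (∫ y in f a..f t, g y) - t * f t
  have hmem : ∀ x ∈ Icc a d, f x ∈ Icc (f a) (f d) := fun x hx =>
    ⟨hf (left_mem_Icc.2 had) hx hx.1, hf hx (right_mem_Icc.2 had) hx.2⟩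
  have hfi : ∀ s ∈ Icc a d, ∀ t ∈ Icc a d, IntervalIntegrable f volume s t :=
    fun s hs t ht => (hf.mono (uIcc_subset_Icc hs ht)).intervalIntegrable
  have hgi : ∀ s ∈ Icc a d, ∀ t ∈ Icc a d, IntervalIntegrable g volume (f s) (f t) :=
    fun s hs t ht => (hg.mono (uIcc_subset_Icc (hmem s hs) (hmem t ht))).intervalIntegrable
  have ha : a ∈ Icc a d := left_mem_Icc.2 had
  have hle : ∀ s ∈ Icc a d, ∀ t ∈ Icc a d, s ≤ t →
      |F t - F s| ≤ |t - s| * |f t - f s| := by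
    intro s hs t ht hst
    have hfst := hf hs ht hst
    have h₁ := integral_add_adjacent_intervals (hfi a ha s hs) (hfi s hs t ht)
    have h₂ := integral_add_adjacent_intervals (hgi a ha s hs) (hgi s hs t ht)
    obtain ⟨h₃, h₄⟩ := (hf.mono (Icc_subset_Icc hs.1 ht.2)).intervalIntegral_bounds hst
    obtain ⟨h₅, h₆⟩ :=
      (hg.mono (Icc_subset_Icc (hmem s hs).1 (hmem t ht).2)).intervalIntegral_bounds hfst
    rw [hgf s hs] at h₅
    rw [hgf t ht] at h₆
    rw [abs_of_nonneg (sub_nonneg.2 hst), abs_of_nonneg (sub_nonneg.2 hfst), abs_le]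
    simp only [F]
    constructor <;> nlinarith
  have hF : F d = F a := by
    refine eq_of_abs_sub_le_mul_abs_sub had hc fun s hs t ht => ?_
    rcases le_total s t with h | h
    · exact hle s hs t ht h
    · rw [abs_sub_comm (F t), abs_sub_comm t, abs_sub_comm (f t)]
      exact hle t ht s hs h
  simp only [F, integral_same] at hF
  linarith

/-- Between distinct points, the integral of a strictly increasing continuous function lies
strictly below the rectangle determined by the value at the upper limit. -/
theorem StrictMonoOn.intervalIntegral_lt {f : ℝ → ℝ} {b d : ℝ} (hf : StrictMonoOn f (uIcc d b))
    (hc : ContinuousOn f (uIcc d b)) (hdb : d ≠ b) :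
    (∫ x in d..b, f x) < (b - d) * f b := by
  rcases hdb.lt_or_gt with h | h
  · rw [uIcc_of_le h.le] at hf hc
    simpa using integral_lt_integral_of_continuousOn_of_le_of_exists_lt
      (g := fun _ => f b) h hc continuousOn_const
      (fun x hx => hf.monotoneOn (Ioc_subset_Icc_self hx) (right_mem_Icc.2 h.le) hx.2)
      ⟨d, left_mem_Icc.2 h.le, hf (left_mem_Icc.2 h.le) (right_mem_Icc.2 h.le) h⟩
  · rw [uIcc_of_ge h.le] at hf hc
    have := integral_lt_integral_of_continuousOn_of_le_of_exists_lt
      (f := fun _ => f b) h continuousOn_const hc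
      (fun x hx => hf.monotoneOn (left_mem_Icc.2 h.le) (Ioc_subset_Icc_self hx) hx.1.le)
      ⟨d, right_mem_Icc.2 h.le, hf (left_mem_Icc.2 h.le) (right_mem_Icc.2 h.le) h⟩
    rw [integral_symm]
    simp only [intervalIntegral.integral_const, smul_eq_mul] at this
    linarith

/-- Minguzzi's inequality (Corollary 2 of Mitroi–Niculescu):
`∫_a^b f + ∫_{f(a)}^c f⁻¹ - bc + a f(a) ≤ (f⁻¹(c) - b)(c - f(b))`,
with equality iff `c = f b`. -/
theorem minguzzi_inequality (f g : ℝ → ℝ)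
    (hf_mono : StrictMonoOn f (Set.Ici 0))
    (hf_cont : ContinuousOn f (Set.Ici 0))
    (hf_nonneg : ∀ x, 0 ≤ x → 0 ≤ f x)
    (hf0 : f 0 = 0)
    (hf_tendsto : Filter.Tendsto f Filter.atTop Filter.atTop)
    (hg_left : ∀ x, 0 ≤ x → g (f x) = x)
    (hg_right : ∀ y, 0 ≤ y → f (g y) = y)
    (hg_nonneg : ∀ y, 0 ≤ y → 0 ≤ g y)
    (a b c : ℝ) (ha : 0 ≤ a) (hab : a ≤ b) (hc : f a ≤ c) :
    ((∫ x in a..b, f x) + (∫ y in f a..c, g y) - b * c + a * f a ≤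
      (g c - b) * (c - f b)) ∧
    ((∫ x in a..b, f x) + (∫ y in f a..c, g y) - b * c + a * f a =
      (g c - b) * (c - f b) ↔ c = f b) := by
  have hc0 : 0 ≤ c := (hf_nonneg a ha).trans hc
  have hd0 : 0 ≤ g c := hg_nonneg c hc0
  have hfd : f (g c) = c := hg_right c hc0
  have had : a ≤ g c := by
    rw [← hf_mono.le_iff_le ha hd0, hfd]
    exact hc
  have hg_mono : MonotoneOn g (Ici 0) := by
    intro x hx y hy hxy
    rw [← hf_mono.le_iff_le (hg_nonneg x hx) (hg_nonneg y hy), hg_right x hx, hg_right y hy]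
    exact hxy
  have hsub : ∀ {x y : ℝ}, 0 ≤ x → 0 ≤ y → uIcc x y ⊆ Ici 0 := fun hx hy _ hz =>
    (le_min hx hy).trans hz.1
  have hsub' : Icc a (g c) ⊆ Ici 0 := fun _ hx => ha.trans hx.1
  have hinv := integral_add_integral_inverse had (hf_mono.monotoneOn.mono hsub')
    (hf_cont.mono hsub')
    (hg_mono.mono fun _ hy => (hf_nonneg a ha).trans hy.1) fun x hx => hg_left x (hsub' hx)
  rw [hfd] at hinv
  have hb0 : 0 ≤ b := ha.trans hab
  have hsplit := integral_add_adjacent_intervals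
    ((hf_cont.mono (hsub ha hd0)).intervalIntegrable (μ := volume))
    ((hf_cont.mono (hsub hd0 hb0)).intervalIntegrable (μ := volume))
  by_cases hcb : g c = b
  · have hcf : c = f b := by rw [← hcb, hfd]
    rw [hcb] at hinv
    have heq : (∫ x in a..b, f x) + (∫ y in f a..c, g y) - b * c + a * f a =
        (g c - b) * (c - f b) := by
      rw [hcb]
      linarith
    exact ⟨heq.le, fun _ => hcf, fun _ => heq⟩
  · have hlt := StrictMonoOn.intervalIntegral_lt (hf_mono.mono (hsub hd0 hb0))
      (hf_cont.mono (hsub hd0 hb0)) hcb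
    have hlt' : (∫ x in a..b, f x) + (∫ y in f a..c, g y) - b * c + a * f a <
        (g c - b) * (c - f b) := by
      linarith
    exact ⟨hlt'.le, fun h => absurd h hlt'.ne,
      fun h => absurd (by rw [h, hg_left b hb0]) hcb⟩
end

section
/- Let f : [0,∞) → [0,∞) be nondecreasing and continuous with f(0) = 0 and lim_{x→∞} f(x) = ∞, with pseudo-inverse f_sup⁻¹(y) = inf{x ≥ 0 : f(x) > y}, let K : [0,∞) × [0,∞) → [0,∞) be Lebesgue locally integrable, and let 0 ≤ a < b and f(a) ≤ c ≤ f(b). Suppose f is convex on the interval [min{f_sup⁻¹(c), b}, max{f_sup⁻¹(c), b}]. Then ∫_a^b (∫_{f(a)}^{f(x)} K(x,y) dy) dx + ∫_{f(a)}^c (∫_a^{f_sup⁻¹(y)} K(x,y) dx) dy − ∫_a^b ∫_{f(a)}^c K(x,y) dy dx ≤ ∫_{f_sup⁻¹(c)}^b ∫_c^{c + ((f(b) − c)/(b − f_sup⁻¹(c)))·(x − f_sup⁻¹(c))} K(x,y) dy dx. -/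
open MeasureTheory Set Filter intervalIntegral

/-- The Galois connection between a monotone continuous function and its pseudo-inverse. -/
lemma le_pseudoInverse_iff {f : ℝ → ℝ} (hf_mono : MonotoneOn f (Set.Ici 0)) (hf0 : f 0 = 0)
    (hf_tendsto : Tendsto f atTop atTop) (hf_cont : ContinuousOn f (Set.Ici 0))
    {x y : ℝ} (hx : 0 ≤ x) (hy : 0 ≤ y) :
    x ≤ sInf {z : ℝ | 0 ≤ z ∧ y < f z} ↔ f x ≤ y := by
  have hne : {z : ℝ | 0 ≤ z ∧ y < f z}.Nonempty :=
    ((eventually_ge_atTop 0).and (hf_tendsto.eventually_gt_atTop y)).exists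
  have hbdd : BddBelow {z : ℝ | 0 ≤ z ∧ y < f z} := ⟨0, fun z hz => hz.1⟩
  constructor
  · intro h
    by_contra! hlt
    have hy_mem : (y + f x) / 2 ∈ Icc (f 0) (f x) := ⟨by linarith, by linarith⟩
    obtain ⟨z, hz, hfz⟩ :=
      intermediate_value_Icc hx (hf_cont.mono Icc_subset_Ici_self) hy_mem
    have hzx : z ≠ x := by
      rintro rfl
      linarith
    have hinf : sInf {z : ℝ | 0 ≤ z ∧ y < f z} ≤ z := csInf_le hbdd ⟨hz.1, by linarith⟩
    exact hzx (le_antisymm hz.2 (h.trans hinf))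
  · intro h
    refine le_csInf hne fun z hz => ?_
    by_contra! hlt
    exact absurd (hf_mono hz.1 hx hlt.le) (not_le.2 (h.trans_lt hz.2))

/-- A convex function lies below its chord. -/
lemma ConvexOn.le_chord {f : ℝ → ℝ} {u v x : ℝ} (hf : ConvexOn ℝ (Icc u v) f) (huv : u < v)
    (hx : x ∈ Icc u v) : f x ≤ f u + (f v - f u) / (v - u) * (x - u) := by
  have hpos : 0 < v - u := sub_pos.2 huv
  have h := hf.2 (left_mem_Icc.2 huv.le) (right_mem_Icc.2 huv.le)
    (div_nonneg (sub_nonneg.2 hx.2) hpos.le) (div_nonneg (sub_nonneg.2 hx.1) hpos.le)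
    (by field_simp; ring)
  have hcomb : ((v - x) / (v - u)) • u + ((x - u) / (v - u)) • v = x := by
    simp only [smul_eq_mul]
    field_simp
    ring
  rw [hcomb] at h
  refine h.trans_eq ?_
  simp only [smul_eq_mul]
  field_simp
  ring

/-- Fubini for the part of a rectangle cut out by a measurable set, integrating first in `y`. -/
lemma integral_indicator_prod_restrict {G : ℝ × ℝ → ℝ} {I J : Set ℝ} {T : Set (ℝ × ℝ)}
    (hT : MeasurableSet T)
    (hG : Integrable G ((volume.restrict I).prod (volume.restrict J))) :
    ∫ p, T.indicator G p ∂((volume.restrict I).prod (volume.restrict J)) =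
      ∫ x in I, ∫ y in J ∩ {y | (x, y) ∈ T}, G (x, y) := by
  rw [integral_prod _ (hG.indicator hT)]
  congr 1
  ext x
  exact setIntegral_indicator (f := fun y => G (x, y)) (measurable_prodMk_left hT)

/-- Fubini for the part of a rectangle cut out by a measurable set, integrating first in `x`. -/
lemma integral_indicator_prod_restrict_symm {G : ℝ × ℝ → ℝ} {I J : Set ℝ} {T : Set (ℝ × ℝ)}
    (hT : MeasurableSet T)
    (hG : Integrable G ((volume.restrict I).prod (volume.restrict J))) :
    ∫ p, T.indicator G p ∂((volume.restrict I).prod (volume.restrict J)) =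
      ∫ y in J, ∫ x in I ∩ {x | (x, y) ∈ T}, G (x, y) := by
  rw [integral_prod_symm _ (hG.indicator hT)]
  congr 1
  ext y
  exact setIntegral_indicator (f := fun x => G (x, y)) (measurable_prodMk_right hT)

/-- The graph of a measurable function is negligible for a product with an atomless measure. -/
lemma ae_snd_ne_apply_fst {F : ℝ → ℝ} (hF : Measurable F) (μ ν : Measure ℝ) [SFinite μ]
    [SFinite ν] [NullSingletonClass ν] : ∀ᵐ p ∂(μ.prod ν), p.2 ≠ F p.1 := by
  have hm : MeasurableSet {p : ℝ × ℝ | p.2 ≠ F p.1} :=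
    (measurableSet_eq_fun measurable_snd (hF.comp measurable_fst)).compl
  rw [Measure.ae_prod_iff_ae_ae hm]
  filter_upwards with x
  exact ν.ae_ne (F x)

/-- Corollary 3 i) of Mitroi–Niculescu: the convexity refinement of the precision
estimate in Young's inequality, in the case `f(a) ≤ c ≤ f(b)`. -/
theorem young_precision_convex_upper (f finv : ℝ → ℝ) (K : ℝ → ℝ → ℝ)
    (hf_mono : MonotoneOn f (Set.Ici 0))
    (hf_nonneg : ∀ x, 0 ≤ x → 0 ≤ f x)
    (hf0 : f 0 = 0)
    (hf_tendsto : Filter.Tendsto f Filter.atTop Filter.atTop)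
    (hfinv : ∀ y, finv y = sInf {x : ℝ | 0 ≤ x ∧ y < f x})
    (hf_cont : ContinuousOn f (Set.Ici 0))
    (hK_nonneg : ∀ x y, 0 ≤ x → 0 ≤ y → 0 ≤ K x y)
    (hK_loc : MeasureTheory.LocallyIntegrableOn (fun p : ℝ × ℝ => K p.1 p.2)
      (Set.Ici (0:ℝ) ×ˢ Set.Ici (0:ℝ)))
    (a b c : ℝ) (ha : 0 ≤ a) (hab : a < b) (hca : f a ≤ c) (hcb : c ≤ f b)
    (hconv : ConvexOn ℝ (Set.Icc (min (finv c) b) (max (finv c) b)) f) :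
    (∫ x in a..b, ∫ y in f a..f x, K x y) +
        (∫ y in f a..c, ∫ x in a..finv y, K x y) -
        (∫ x in a..b, ∫ y in f a..c, K x y) ≤
      ∫ x in finv c..b,
        ∫ y in c..(c + (f b - c) / (b - finv c) * (x - finv c)), K x y := by
  have hgal : ∀ x y, 0 ≤ x → 0 ≤ y → (x ≤ finv y ↔ f x ≤ y) := fun x y hx hy => by
    rw [hfinv]
    exact le_pseudoInverse_iff hf_mono hf0 hf_tendsto hf_cont hx hy
  have hb : 0 ≤ b := ha.trans hab.le
  have hfa : 0 ≤ f a := hf_nonneg a ha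
  have hc : 0 ≤ c := hfa.trans hca
  have ham : a ≤ finv c := (hgal a c ha hc).2 hca
  have hm0 : 0 ≤ finv c := ha.trans ham
  have hfm : f (finv c) ≤ c := (hgal _ c hm0 hc).1 le_rfl
  have hbm : b ≤ finv c → f b = c := fun h => le_antisymm ((hgal b c hb hc).1 h) hcb
  have hfm_eq : f (finv c) = c := by
    refine le_antisymm hfm ?_
    obtain ⟨z, hz, hfz⟩ := intermediate_value_Icc hab.le
      (hf_cont.mono fun x hx => ha.trans hx.1) ⟨hca, hcb⟩
    have hz0 : 0 ≤ z := ha.trans hz.1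
    exact hfz.symm.le.trans (hf_mono hz0 hm0 ((hgal z c hz0 hc).2 hfz.le))
  set ℓ : ℝ → ℝ := fun x => c + (f b - c) / (b - finv c) * (x - finv c) with hℓ
  have hchord : ∀ x, finv c < x → x ≤ b → f x ≤ ℓ x := by
    intro x hx hxb
    have hmb := hx.trans_le hxb
    rw [min_eq_left hmb.le, max_eq_right hmb.le] at hconv
    simpa only [hfm_eq] using hconv.le_chord hmb ⟨hx.le, hxb⟩
  have hℓ_le : ∀ x, finv c < x → x ≤ b → ℓ x ≤ f b := by
    intro x hx hxb
    have hmb : 0 < b - finv c := by linarith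
    have hq : 0 ≤ (f b - c) / (b - finv c) := div_nonneg (by linarith) hmb.le
    calc ℓ x ≤ c + (f b - c) / (b - finv c) * (b - finv c) := by
          simp only [hℓ]
          gcongr
      _ = f b := by
          rw [div_mul_cancel₀ _ hmb.ne']
          ring
  have hℓ_ge : ∀ x, finv c < x → x ≤ b → c ≤ ℓ x := fun x hx hxb =>
    (hfm_eq.symm.le.trans (hf_mono hm0 (hm0.trans hx.le) hx.le)).trans (hchord x hx hxb)
  set F : ℝ → ℝ := fun x => f (max x 0) with hF
  have hF_cont : Continuous F :=
    hf_cont.comp_continuous (by fun_prop) fun x => le_max_right x 0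
  have hFf : ∀ x, 0 ≤ x → F x = f x := fun x hx => by simp only [hF, max_eq_left hx]
  set G : ℝ × ℝ → ℝ := fun p => K p.1 p.2
  set M : Measure (ℝ × ℝ) :=
    (volume.restrict (Ioc a b)).prod (volume.restrict (Ioc (f a) (f b))) with hM
  have hM_eq : M = volume.restrict (Ioc a b ×ˢ Ioc (f a) (f b)) := by
    rw [hM, Measure.prod_restrict, Measure.volume_eq_prod]
  have hG : Integrable G M := by
    rw [hM_eq]
    have hcpt : IntegrableOn G (Icc a b ×ˢ Icc (f a) (f b)) :=
      hK_loc.integrableOn_compact_subset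
        (prod_mono (fun x hx => ha.trans hx.1) fun y hy => hfa.trans hy.1)
        (isCompact_Icc.prod isCompact_Icc)
    exact hcpt.mono_set (prod_mono Ioc_subset_Icc_self Ioc_subset_Icc_self)
  let below : Set (ℝ × ℝ) := {p | p.2 ≤ F p.1}
  let above : Set (ℝ × ℝ) := {p | F p.1 ≤ p.2 ∧ p.2 ≤ c}
  let rect : Set (ℝ × ℝ) := {p | p.2 ≤ c}
  let triangle : Set (ℝ × ℝ) := {p | finv c < p.1 ∧ c < p.2 ∧ p.2 ≤ ℓ p.1}
  have hℓ_cont : Continuous ℓ := by fun_prop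
  have hbelow : MeasurableSet below :=
    measurableSet_le measurable_snd (hF_cont.measurable.comp measurable_fst)
  have hrect : MeasurableSet rect := measurableSet_le measurable_snd measurable_const
  have habove : MeasurableSet above :=
    (measurableSet_le (hF_cont.measurable.comp measurable_fst) measurable_snd).inter hrect
  have htriangle : MeasurableSet triangle :=
    (measurableSet_lt measurable_const measurable_fst).inter
      ((measurableSet_lt measurable_const measurable_snd).inter
        (measurableSet_le measurable_snd (hℓ_cont.measurable.comp measurable_fst)))
  have ebelow : (∫ x in a..b, ∫ y in f a..f x, K x y) = ∫ p, below.indicator G p ∂M := by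
    rw [integral_indicator_prod_restrict hbelow hG, integral_of_le hab.le]
    refine setIntegral_congr_fun measurableSet_Ioc fun x hx => ?_
    have hx0 : 0 ≤ x := ha.trans hx.1.le
    have hset : Ioc (f a) (f b) ∩ {y | (x, y) ∈ below} = Ioc (f a) (f x) := by
      ext y
      have := hf_mono hx0 hb hx.2
      simp only [below, mem_inter_iff, mem_Ioc, mem_ofPred_eq, hFf x hx0]
      grind
    simp only [hset, integral_of_le (hf_mono ha hx0 hx.1.le)]
    rfl
  have erect : (∫ x in a..b, ∫ y in f a..c, K x y) = ∫ p, rect.indicator G p ∂M := by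
    rw [integral_indicator_prod_restrict hrect hG, integral_of_le hab.le]
    refine setIntegral_congr_fun measurableSet_Ioc fun x _ => ?_
    have hset : Ioc (f a) (f b) ∩ {y | (x, y) ∈ rect} = Ioc (f a) c := by
      ext y
      simp only [rect, mem_inter_iff, mem_Ioc, mem_ofPred_eq]
      grind
    simp only [hset, integral_of_le hca]
    rfl
  have eabove : (∫ y in f a..c, ∫ x in a..finv y, K x y) = ∫ p, above.indicator G p ∂M := by
    rw [integral_indicator_prod_restrict_symm habove hG, integral_of_le hca,
      setIntegral_eq_of_subset_of_forall_sdiff_eq_zero (s := Ioc (f a) c)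
        measurableSet_Ioc (Ioc_subset_Ioc_right hcb), integral_Ioc_eq_integral_Ioo,
      integral_Ioc_eq_integral_Ioo]
    · refine setIntegral_congr_fun measurableSet_Ioo fun y hy => ?_
      have hy0 : 0 ≤ y := hfa.trans hy.1.le
      have hinv_lt : finv y < b :=
        not_le.1 fun h => (hy.2.trans_le hcb).not_ge ((hgal b y hb hy0).1 h)
      have hset : Ioc a b ∩ {x | (x, y) ∈ above} = Ioc a (finv y) := by
        ext x
        simp only [above, mem_inter_iff, mem_Ioc, mem_ofPred_eq]
        constructor
        · rintro ⟨⟨hax, -⟩, hFx, -⟩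
          have hx0 : 0 ≤ x := ha.trans hax.le
          exact ⟨hax, (hgal x y hx0 hy0).2 (hFf x hx0 ▸ hFx)⟩
        · rintro ⟨hax, hxy⟩
          have hx0 : 0 ≤ x := ha.trans hax.le
          exact ⟨⟨hax, hxy.trans hinv_lt.le⟩, (hFf x hx0).trans_le ((hgal x y hx0 hy0).1 hxy),
            hy.2.le⟩
      simp only [hset, integral_of_le ((hgal a y ha hy0).2 hy.1.le)]
      rfl
    · intro y hy
      have hset : Ioc a b ∩ {x | (x, y) ∈ above} = ∅ := by
        ext x
        simp only [above, mem_inter_iff, mem_Ioc, mem_ofPred_eq, mem_empty_iff_false, iff_false]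
        exact fun h => hy.2 ⟨hy.1.1, h.2.2⟩
      rw [hset, setIntegral_empty]
  have etriangle : (∫ x in finv c..b, ∫ y in c..ℓ x, K x y) =
      ∫ p, triangle.indicator G p ∂M := by
    rw [integral_indicator_prod_restrict htriangle hG]
    rcases lt_or_ge (finv c) b with hmb | hmb
    · rw [integral_of_le hmb.le,
        setIntegral_eq_of_subset_of_forall_sdiff_eq_zero (s := Ioc (finv c) b)
          measurableSet_Ioc (Ioc_subset_Ioc_left ham)]
      · refine setIntegral_congr_fun measurableSet_Ioc fun x hx => ?_
        have hset : Ioc (f a) (f b) ∩ {y | (x, y) ∈ triangle} = Ioc c (ℓ x) := by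
          ext y
          have := hℓ_le x hx.1 hx.2
          have := hx.1
          simp only [triangle, mem_inter_iff, mem_Ioc, mem_ofPred_eq]
          grind
        simp only [hset, integral_of_le (hℓ_ge x hx.1 hx.2)]
        rfl
      · intro x hx
        have hset : Ioc (f a) (f b) ∩ {y | (x, y) ∈ triangle} = ∅ := by
          ext y
          simp only [triangle, mem_inter_iff, mem_ofPred_eq, mem_empty_iff_false, iff_false]
          exact fun h => hx.2 ⟨h.2.1, hx.1.2⟩
        rw [hset, setIntegral_empty]
    · have hℓc : ∀ x, ℓ x = c := fun x => by simp [hℓ, hbm hmb]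
      have hset : ∀ x, Ioc (f a) (f b) ∩ {y | (x, y) ∈ triangle} = ∅ := by
        intro x
        ext y
        simp only [triangle, hℓc, mem_inter_iff, mem_ofPred_eq, mem_empty_iff_false, iff_false]
        exact fun h => h.2.2.1.not_ge h.2.2.2
      simp [hℓc, hset]
  rw [ebelow, eabove, erect, etriangle, sub_le_iff_le_add,
    ← integral_add (hG.indicator hbelow) (hG.indicator habove),
    ← integral_add (hG.indicator htriangle) (hG.indicator hrect)]
  refine integral_mono_ae ((hG.indicator hbelow).add (hG.indicator habove))
    ((hG.indicator htriangle).add (hG.indicator hrect)) ?_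
  have hmem : ∀ᵐ p ∂M, p ∈ Ioc a b ×ˢ Ioc (f a) (f b) := by
    rw [hM_eq]
    exact ae_restrict_mem (measurableSet_Ioc.prod measurableSet_Ioc)
  filter_upwards [hmem, ae_snd_ne_apply_fst hF_cont.measurable _ _] with ⟨x, y⟩ hp hne
  obtain ⟨⟨hax, hxb⟩, hay, hyb⟩ := hp
  have hx0 : 0 ≤ x := ha.trans hax.le
  have hnonneg : 0 ≤ G (x, y) := hK_nonneg x y hx0 (hfa.trans hay.le)
  have htri : c < y → y ≤ F x → finv c < x ∧ y ≤ ℓ x := by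
    intro hcy hyF
    rw [hFf x hx0] at hyF
    have hmx : finv c < x :=
      not_le.1 fun h => (hcy.trans_le hyF).not_ge ((hgal x c hx0 hc).1 h)
    exact ⟨hmx, hyF.trans (hchord x hmx hxb)⟩
  simp only [indicator_apply, below, above, rect, triangle, mem_ofPred_eq]
  clear_value F ℓ G
  rcases le_or_gt y c with hyc | hcy
  · rcases lt_or_gt_of_ne hne with h | h
    · simp [h.le, h.not_ge, hyc, hyc.not_gt]
    · simp [h.le, h.not_ge, hyc, hyc.not_gt]
  · by_cases h : y ≤ F x
    · simp [h, hcy, hcy.not_ge, htri hcy h]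
    · simp only [h, hcy, hcy.not_ge, and_false, if_false, add_zero]
      split_ifs <;> simp [hnonneg]
end

section
/- (Jakšetić–Pečarić upper bound.) Let f : [0,∞) → [0,∞) be strictly increasing and differentiable with f(0) = 0 and lim_{x→∞} f(x) = ∞, let b > 0 and 0 ≤ c < f(b), and suppose the derivative f′ is increasing on the interval [min{f⁻¹(c), b}, max{f⁻¹(c), b}]. Then ∫_0^b f(x) dx + ∫_0^c f⁻¹(y) dy − bc ≤ (1/2)·(f⁻¹(c) − b)·(c − f(b)). -/
open MeasureTheory Set Filter intervalIntegral

/-- The case of equality in Young's inequality for integrals. -/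
theorem integral_add_integral_leftInverse_eq_mul {f g f' : ℝ → ℝ} {a : ℝ} (ha : 0 ≤ a)
    (hf : Continuous f) (hg : Continuous g) (hf0 : f 0 = 0)
    (hderiv : ∀ x ∈ Ico 0 a, HasDerivWithinAt f (f' x) (Ici x) x)
    (hgf : ∀ x ∈ Icc 0 a, g (f x) = x) :
    (∫ x in (0:ℝ)..a, f x) + ∫ y in (0:ℝ)..f a, g y = a * f a := by
  have hF (x : ℝ) : HasDerivAt (fun u => ∫ t in (0:ℝ)..u, f t) (f x) x :=
    hf.integral_hasStrictDerivAt 0 x |>.hasDerivAt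
  have hG (y : ℝ) : HasDerivAt (fun u => ∫ t in (0:ℝ)..u, g t) (g y) y :=
    hg.integral_hasStrictDerivAt 0 y |>.hasDerivAt
  have hF_cont : Continuous fun u => ∫ t in (0:ℝ)..u, f t :=
    continuous_iff_continuousAt.2 fun x => (hF x).continuousAt
  have hG_cont : Continuous fun u => ∫ t in (0:ℝ)..u, g t :=
    continuous_iff_continuousAt.2 fun y => (hG y).continuousAt
  refine eq_of_has_deriv_right_eq (f' := fun x => f x + x * f' x)
    (f := fun u => (∫ x in (0:ℝ)..u, f x) + ∫ y in (0:ℝ)..f u, g y) (g := fun u => u * f u)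
    (fun x hx => ?_) (fun x hx => ?_) (hF_cont.add (hG_cont.comp hf)).continuousOn
    (continuous_id.mul hf).continuousOn (by simp [hf0]) a (right_mem_Icc.2 ha)
  · have h := (hF x).hasDerivWithinAt.add ((hG (f x)).comp_hasDerivWithinAt x (hderiv x hx))
    rwa [hgf x (Ico_subset_Icc_self hx)] at h
  · simpa using! (hasDerivWithinAt_id x (Ici x)).mul (hderiv x hx)

/-- A monotone surjection of `[0, ∞)` onto itself, extended by the identity to `(-∞, 0]`,
is continuous. -/
theorem continuous_comp_max_zero_add_min_zero {g : ℝ → ℝ} (hg : MonotoneOn g (Ici 0))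
    (hg_surj : SurjOn g (Ici 0) (Ici 0)) (hg0 : g 0 = 0) :
    Continuous fun y => g (max y 0) + min y 0 := by
  refine Monotone.continuous_of_surjective (fun x y hxy => ?_) fun z => ?_
  · exact add_le_add (hg (mem_Ici.2 (le_max_right _ _)) (mem_Ici.2 (le_max_right _ _))
      (max_le_max_right 0 hxy))
      (min_le_min_right 0 hxy)
  · rcases le_total 0 z with hz | hz
    · obtain ⟨y, hy, rfl⟩ := hg_surj hz
      have hy : (0 : ℝ) ≤ y := hy
      exact ⟨y, by simp [hy]⟩
    · exact ⟨z, by simp [hz, hg0]⟩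

/-- The upper Hermite–Hadamard inequality. -/
theorem ConvexOn.integral_le_trapezoid {f : ℝ → ℝ} {a b : ℝ} (hab : a < b)
    (hf : ConvexOn ℝ (Icc a b) f) (hcont : ContinuousOn f (Icc a b)) :
    ∫ x in a..b, f x ≤ (b - a) * (f a + f b) / 2 := by
  have hba : 0 < b - a := sub_pos.2 hab
  set m := (f b - f a) / (b - a) with hm
  have hle : ∀ x ∈ Icc a b, f x ≤ f a + m * (x - a) := by
    intro x hx
    have h := hf.2 (left_mem_Icc.2 hab.le) (right_mem_Icc.2 hab.le)
      (div_nonneg (sub_nonneg.2 hx.2) hba.le) (div_nonneg (sub_nonneg.2 hx.1) hba.le)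
      (by field_simp; ring)
    simp only [smul_eq_mul] at h
    refine (congrArg f ?_).trans_le (h.trans_eq ?_)
    · rw [div_mul_eq_mul_div, div_mul_eq_mul_div, ← add_div, eq_div_iff hba.ne']
      ring
    · rw [hm]
      field_simp
      ring
  have hline : ∫ x in a..b, (f a + m * (x - a)) = (b - a) * (f a + f b) / 2 := by
    rw [intervalIntegral.integral_add intervalIntegrable_const
      ((by fun_prop : Continuous fun x => m * (x - a)).intervalIntegrable a b),
      intervalIntegral.integral_const_mul,
      intervalIntegral.integral_sub intervalIntegrable_id intervalIntegrable_const]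
    simp only [intervalIntegral.integral_const, integral_id, smul_eq_mul, hm]
    field_simp
    ring
  rw [← hline]
  exact intervalIntegral.integral_mono_on hab.le
    (hcont.intervalIntegrable_of_Icc hab.le)
    ((by fun_prop : Continuous fun x => f a + m * (x - a)).intervalIntegrable a b) hle

/-- The Jakšetić–Pečarić upper bound: if `f` is increasing and differentiable with an
increasing derivative on the interval between `f⁻¹(c)` and `b`, and `c < f(b)`, then
`∫_0^b f + ∫_0^c f⁻¹ - bc ≤ (1/2)(f⁻¹(c) - b)(c - f(b))`. -/
theorem jaksetic_pecaric_upper (f g f' : ℝ → ℝ)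
    (hf_mono : StrictMonoOn f (Set.Ici 0))
    (hf_cont : ContinuousOn f (Set.Ici 0))
    (hf_nonneg : ∀ x, 0 ≤ x → 0 ≤ f x)
    (hf0 : f 0 = 0)
    (hf_tendsto : Filter.Tendsto f Filter.atTop Filter.atTop)
    (hg_left : ∀ x, 0 ≤ x → g (f x) = x)
    (hg_right : ∀ y, 0 ≤ y → f (g y) = y)
    (hg_nonneg : ∀ y, 0 ≤ y → 0 ≤ g y)
    (hf_deriv : ∀ x, 0 ≤ x → HasDerivAt f (f' x) x)
    (b c : ℝ) (hb : 0 < b) (hc0 : 0 ≤ c) (hc : c < f b)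
    (hf'_mono : MonotoneOn f' (Set.Icc (min (g c) b) (max (g c) b))) :
    (∫ x in (0:ℝ)..b, f x) + (∫ y in (0:ℝ)..c, g y) - b * c ≤
      (1 / 2) * (g c - b) * (c - f b) := by
  have hg0 : g 0 = 0 := by simpa [hf0] using hg_left 0 le_rfl
  have ha0 : 0 ≤ g c := hg_nonneg c hc0
  have hfa : f (g c) = c := hg_right c hc0
  have hab : g c < b := by
    rwa [← hf_mono.lt_iff_lt (mem_Ici.2 ha0) (mem_Ici.2 hb.le), hfa]
  rw [min_eq_left hab.le, max_eq_right hab.le] at hf'_mono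
  have hg_mono : MonotoneOn g (Ici 0) := by
    intro x hx y hy hxy
    rwa [← hf_mono.le_iff_le (hg_nonneg x hx) (hg_nonneg y hy), hg_right x hx, hg_right y hy]
  have hcont : ContinuousOn f (Icc (g c) b) :=
    hf_cont.mono fun x hx => ha0.trans hx.1
  have hconv : ConvexOn ℝ (Icc (g c) b) f := by
    have hd : ∀ x ∈ Ioo (g c) b, deriv f x = f' x :=
      fun x hx => (hf_deriv x (ha0.trans hx.1.le)).deriv
    refine MonotoneOn.convexOn_of_deriv (convex_Icc _ _) hcont ?_ ?_ <;> rw [interior_Icc]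
    · exact fun x hx =>
        (hf_deriv x (ha0.trans hx.1.le)).differentiableAt.differentiableWithinAt
    · exact (hf'_mono.mono Ioo_subset_Icc_self).congr fun x hx => (hd x hx).symm
  have htrap := hconv.integral_le_trapezoid hab hcont
  have hyoung : (∫ x in (0:ℝ)..g c, f x) + ∫ y in (0:ℝ)..c, g y = g c * c := by
    have h := integral_add_integral_leftInverse_eq_mul (f := fun x => f (max x 0))
      (g := fun y => g (max y 0) + min y 0) (f' := f') ha0
      (hf_cont.comp_continuous (by fun_prop) fun x => le_max_right x 0)
      (continuous_comp_max_zero_add_min_zero hg_mono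
        (fun x hx => ⟨f x, hf_nonneg x hx, hg_left x hx⟩) hg0)
      (by simpa using hf0)
      (fun x hx => (hf_deriv x hx.1).hasDerivWithinAt.congr
        (fun y hy => by rw [max_eq_left (hx.1.trans hy)]) (by rw [max_eq_left hx.1]))
      (fun x hx => by
        simp only [max_eq_left hx.1, max_eq_left (hf_nonneg x hx.1),
          min_eq_right (hf_nonneg x hx.1), hg_left x hx.1, add_zero])
    simp only [max_eq_left ha0, hfa] at h
    rw [← h]
    congr 1 <;> refine intervalIntegral.integral_congr fun x hx => ?_
    · rw [uIcc_of_le ha0] at hx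
      simp [hx.1]
    · rw [uIcc_of_le hc0] at hx
      simp [hx.1]
  have hsplit := intervalIntegral.integral_add_adjacent_intervals (μ := volume)
    ((hf_cont.mono fun x hx => hx.1).intervalIntegrable_of_Icc ha0)
    (hcont.intervalIntegrable_of_Icc hab.le)
  rw [hfa] at htrap
  linarith
end

section
/- (Young's inequality in c-convexity form for hyperbolically absolutely continuous cost functions.) Let K : [a,b] × [A,B] → [0,∞) be Lebesgue integrable, define c(x,y) = ∫_a^x ∫_A^y K(s,t) dt ds for (x,y) ∈ [a,b] × [A,B], and let f : [a,b] → [A,B] be a nondecreasing function with f(a) = A, with pseudo-inverse f_sup⁻¹(s) = inf{x ∈ [a,b] : f(x) > s} (where inf ∅ = b). Then for all (x,y) ∈ [a,b] × [A,B]: c(x,y) − c(a, f(a)) ≤ ∫_a^x (∫_A^{f(t)} K(t,s) ds) dt + ∫_A^y (∫_a^{f_sup⁻¹(s)} K(t,s) dt) ds. -/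
open MeasureTheory Set Filter intervalIntegral Classical

/-- An iterated integral over the region below a graph as an iterated integral of an
indicator over the whole plane. -/
theorem intervalIntegral_iterated_eq_integral_indicator {a x A : ℝ} {g : ℝ → ℝ}
    (k : ℝ → ℝ → ℝ) (hax : a ≤ x) (hg : ∀ t ∈ Ioc a x, A ≤ g t) :
    (∫ t in a..x, ∫ s in A..g t, k t s) =
      ∫ t, ∫ s, {p : ℝ × ℝ | p.1 ∈ Ioc a x ∧ p.2 ∈ Ioc A (g p.1)}.indicator
        (fun p => k p.1 p.2) (t, s) := by
  rw [integral_of_le hax, ← MeasureTheory.integral_indicator measurableSet_Ioc]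
  refine integral_congr_ae (Eventually.of_forall fun t => ?_)
  by_cases ht : t ∈ Ioc a x
  · simp only [indicator_of_mem ht]
    rw [integral_of_le (hg t ht), ← MeasureTheory.integral_indicator measurableSet_Ioc]
    refine integral_congr_ae (Eventually.of_forall fun s => ?_)
    simp only [indicator_apply, mem_ofPred_eq, ht, true_and]
  · simp only [indicator_of_notMem ht]
    refine (integral_eq_zero_of_ae (Eventually.of_forall fun s => ?_)).symm
    exact indicator_of_notMem (fun h => ht h.1) _

theorem measurableSet_Ioc_under_graph (a x A : ℝ) {g : ℝ → ℝ} (hg : Measurable g) :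
    MeasurableSet {p : ℝ × ℝ | p.1 ∈ Ioc a x ∧ p.2 ∈ Ioc A (g p.1)} :=
  (measurable_fst measurableSet_Ioc).inter
    ((measurableSet_lt measurable_const measurable_snd).inter
      (measurableSet_le measurable_snd (hg.comp measurable_fst)))

/-- An iterated integral over the region below a graph as a planar integral. -/
theorem intervalIntegral_iterated_eq_integral_prod {a x A : ℝ} {g : ℝ → ℝ}
    {k : ℝ → ℝ → ℝ} {R : Set (ℝ × ℝ)} (hk : IntegrableOn (fun p : ℝ × ℝ => k p.1 p.2) R)
    (hax : a ≤ x) (hg : ∀ t ∈ Ioc a x, A ≤ g t) (hgm : Measurable g)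
    (hR : {p : ℝ × ℝ | p.1 ∈ Ioc a x ∧ p.2 ∈ Ioc A (g p.1)} ⊆ R) :
    (∫ t in a..x, ∫ s in A..g t, k t s) =
      ∫ p, {p : ℝ × ℝ | p.1 ∈ Ioc a x ∧ p.2 ∈ Ioc A (g p.1)}.indicator
        (fun p => k p.1 p.2) p := by
  rw [intervalIntegral_iterated_eq_integral_indicator k hax hg]
  exact (integral_prod _ ((integrable_indicator_iff
    (measurableSet_Ioc_under_graph a x A hgm)).2 (hk.mono_set hR))).symm

/-- Theorem 4 of Mitroi–Niculescu: Young's inequality for an absolutely continuous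
(in the hyperbolic sense) cost function `c(x,y) = ∫_a^x ∫_A^y K`, a nondecreasing
`f : [a,b] → [A,B]` with `f a = A`, and pseudo-inverse
`finv s = inf {x ∈ [a,b] : f x > s}` (with the convention `inf ∅ = b`). -/
theorem young_inequality_cost (a b A B : ℝ) (hab : a < b) (hAB : A < B)
    (K : ℝ → ℝ → ℝ) (c : ℝ → ℝ → ℝ) (f finv : ℝ → ℝ)
    (hK_nonneg : ∀ x y, x ∈ Set.Icc a b → y ∈ Set.Icc A B → 0 ≤ K x y)
    (hK_int : MeasureTheory.IntegrableOn (fun p : ℝ × ℝ => K p.1 p.2)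
      (Set.Icc a b ×ˢ Set.Icc A B))
    (hc : ∀ x y, c x y = ∫ s in a..x, ∫ t in A..y, K s t)
    (hf_mono : MonotoneOn f (Set.Icc a b))
    (hf_maps : ∀ x ∈ Set.Icc a b, f x ∈ Set.Icc A B)
    (hfa : f a = A)
    (hfinv : ∀ s, finv s =
      if {x : ℝ | x ∈ Set.Icc a b ∧ s < f x}.Nonempty
        then sInf {x : ℝ | x ∈ Set.Icc a b ∧ s < f x} else b)
    (x y : ℝ) (hx : x ∈ Set.Icc a b) (hy : y ∈ Set.Icc A B) :
    c x y - c a (f a) ≤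
      (∫ t in a..x, ∫ s in A..f t, K t s) + ∫ s in A..y, ∫ t in a..finv s, K t s := by
  have hmem : ∀ s, finv s ∈ Icc a b := by
    intro s
    rw [hfinv]
    split_ifs with h
    · obtain ⟨z, hz⟩ := h
      exact ⟨le_csInf ⟨z, hz⟩ fun w hw => hw.1.1,
        (csInf_le ⟨a, fun w hw => hw.1.1⟩ hz).trans hz.1.2⟩
    · exact right_mem_Icc.2 hab.le
  have hmono : Monotone finv := by
    intro s₁ s₂ hs
    by_cases h : {x : ℝ | x ∈ Set.Icc a b ∧ s₂ < f x}.Nonempty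
    · have hsub : {x : ℝ | x ∈ Set.Icc a b ∧ s₂ < f x} ⊆
          {x : ℝ | x ∈ Set.Icc a b ∧ s₁ < f x} := fun z hz => ⟨hz.1, hs.trans_lt hz.2⟩
      rw [hfinv s₁, hfinv s₂, if_pos h, if_pos (h.mono hsub)]
      exact csInf_le_csInf ⟨a, fun w hw => hw.1.1⟩ h hsub
    · rw [hfinv s₂, if_neg h]
      exact (hmem s₁).2
  have hle : ∀ t ∈ Icc a b, ∀ s, f t < s → t ≤ finv s := by
    intro t ht s hts
    rw [hfinv]
    split_ifs with h
    · refine le_csInf h fun w hw => ?_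
      by_contra! hwt
      exact (hw.2.trans_le (hf_mono hw.1 ht hwt.le)).not_gt hts
    · exact ht.2
  obtain ⟨g, hgmono, hgf⟩ : ∃ g : ℝ → ℝ, Monotone g ∧ ∀ t ∈ Icc a b, g t = f t := by
    refine ⟨fun t => f (max a (min b t)), fun t₁ t₂ h => ?_, fun t ht => ?_⟩
    · exact hf_mono ⟨le_max_left _ _, max_le hab.le (min_le_left _ _)⟩
        ⟨le_max_left _ _, max_le hab.le (min_le_left _ _)⟩ (by gcongr)
    · simp only [min_eq_right ht.2, max_eq_right ht.1]
  have hIcc : ∀ t ∈ Ioc a x, t ∈ Icc a b := fun t ht => ⟨ht.1.le, ht.2.trans hx.2⟩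
  have hgI : ∀ t ∈ Ioc a x, g t ∈ Icc A B := fun t ht => by
    rw [hgf t (hIcc t ht)]
    exact hf_maps t (hIcc t ht)
  have hfg : (∫ t in a..x, ∫ s in A..f t, K t s) = ∫ t in a..x, ∫ s in A..g t, K t s := by
    rw [integral_of_le hx.1, integral_of_le hx.1]
    refine setIntegral_congr_fun measurableSet_Ioc fun t ht => ?_
    simp only [hgf t (hIcc t ht)]
  have hR₀ : {p : ℝ × ℝ | p.1 ∈ Ioc a x ∧ p.2 ∈ Ioc A y} ⊆ Icc a b ×ˢ Icc A B :=
    fun p hp => ⟨hIcc _ hp.1, hp.2.1.le, hp.2.2.trans hy.2⟩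
  have hR₁ : {p : ℝ × ℝ | p.1 ∈ Ioc a x ∧ p.2 ∈ Ioc A (g p.1)} ⊆ Icc a b ×ˢ Icc A B :=
    fun p hp => ⟨hIcc _ hp.1, hp.2.1.le, hp.2.2.trans (hgI _ hp.1).2⟩
  have hR₂ : {p : ℝ × ℝ | p.1 ∈ Ioc A y ∧ p.2 ∈ Ioc a (finv p.1)} ⊆ Icc A B ×ˢ Icc a b :=
    fun p hp => ⟨⟨hp.1.1.le, hp.1.2.trans hy.2⟩, hp.2.1.le, hp.2.2.trans (hmem _).2⟩
  have hK_swap : IntegrableOn (fun p : ℝ × ℝ => K p.2 p.1) (Icc A B ×ˢ Icc a b) := by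
    rw [IntegrableOn, Measure.volume_eq_prod, ← Measure.prod_restrict]
    rw [IntegrableOn, Measure.volume_eq_prod, ← Measure.prod_restrict] at hK_int
    exact hK_int.swap
  have hm₀ := measurableSet_Ioc_under_graph a x A (g := fun _ => y) measurable_const
  have hm₁ := measurableSet_Ioc_under_graph a x A hgmono.measurable
  have hm₂ := measurableSet_Ioc_under_graph A y a hmono.measurable
  have hi₀ := (integrable_indicator_iff hm₀).2 (hK_int.mono_set hR₀)
  have hi₁ := (integrable_indicator_iff hm₁).2 (hK_int.mono_set hR₁)
  have hi₂ := (integrable_indicator_iff hm₂).2 (hK_swap.mono_set hR₂)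
  have hi₂' := hi₂.swap
  rw [hc, hc, integral_same, sub_zero, hfg,
    intervalIntegral_iterated_eq_integral_prod hK_int hx.1 (g := fun _ => y)
      (fun _ _ => hy.1) measurable_const hR₀,
    intervalIntegral_iterated_eq_integral_prod hK_int hx.1 (fun t ht => (hgI t ht).1)
      hgmono.measurable hR₁,
    intervalIntegral_iterated_eq_integral_prod (k := fun s t => K t s) hK_swap hy.1
      (fun s _ => (hmem s).1) hmono.measurable hR₂,
    Measure.volume_eq_prod, ← integral_prod_swap (μ := volume) (ν := volume)
      ({p : ℝ × ℝ | p.1 ∈ Ioc A y ∧ p.2 ∈ Ioc a (finv p.1)}.indicator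
        fun p => K p.2 p.1)]
  refine (MeasureTheory.integral_mono hi₀ (hi₁.add hi₂') fun p => ?_).trans_eq
    (MeasureTheory.integral_add hi₁ hi₂')
  have hn₁ : 0 ≤ {p : ℝ × ℝ | p.1 ∈ Ioc a x ∧ p.2 ∈ Ioc A (g p.1)}.indicator
      (fun p => K p.1 p.2) p :=
    indicator_nonneg (fun q hq => hK_nonneg _ _ (hR₁ hq).1 (hR₁ hq).2) p
  have hn₂ : 0 ≤ {p : ℝ × ℝ | p.1 ∈ Ioc A y ∧ p.2 ∈ Ioc a (finv p.1)}.indicator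
      (fun p => K p.2 p.1) p.swap :=
    indicator_nonneg (fun q hq => hK_nonneg _ _ (hR₂ hq).2 (hR₂ hq).1) p.swap
  rw [Pi.add_apply, Function.comp_apply]
  by_cases hp : p ∈ {p : ℝ × ℝ | p.1 ∈ Ioc a x ∧ p.2 ∈ Ioc A y}
  · rw [indicator_of_mem hp]
    obtain ⟨h₁, h₂⟩ := hp
    rcases le_or_gt p.2 (f p.1) with h | h
    · rw [← hgf _ (hIcc _ h₁)] at h
      have hp₁ : p ∈ {p : ℝ × ℝ | p.1 ∈ Ioc a x ∧ p.2 ∈ Ioc A (g p.1)} := ⟨h₁, h₂.1, h⟩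
      rw [indicator_of_mem hp₁]
      exact le_add_of_nonneg_right hn₂
    · refine le_add_of_nonneg_of_le hn₁ (le_of_eq ?_)
      have hp₂ : p.swap ∈ {p : ℝ × ℝ | p.1 ∈ Ioc A y ∧ p.2 ∈ Ioc a (finv p.1)} :=
        ⟨h₂, h₁.1, hle _ (hIcc _ h₁) _ h⟩
      rw [indicator_of_mem hp₂, Prod.snd_swap, Prod.fst_swap]
  · rw [indicator_of_notMem hp]
    exact add_nonneg hn₁ hn₂
end

section
/- Let {1/s} denote the fractional part of 1/s for s > 0, with the convention {1/0} = 0. Then for every nondecreasing function f : [0,∞) → [0,∞) with f(0) = 0 and lim_{x→∞} f(x) = ∞, with pseudo-inverse f_sup⁻¹(t) = inf{x ≥ 0 : f(x) > t}, and all x, y ≥ 0: (∫_0^x {1/s} ds)·(∫_0^y {1/t} dt) ≤ ∫_0^x ({1/s} · ∫_0^{f(s)} {1/t} dt) ds + ∫_0^y ({1/t} · ∫_0^{f_sup⁻¹(t)} {1/s} ds) dt. -/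
open MeasureTheory Set Filter intervalIntegral

/-- A monotone upper limit in a primitive of `q` keeps the product with `p` integrable. -/
lemma integrableOn_mul_integral_monotoneOn {p q φ : ℝ → ℝ}
    (hp : ∀ a b, IntervalIntegrable p volume a b) (hq : ∀ a b, IntervalIntegrable q volume a b)
    (hq0 : ∀ t, 0 ≤ q t) (hφ : MonotoneOn φ (Set.Ici 0)) (hφ0 : ∀ s, 0 ≤ s → 0 ≤ φ s)
    {x : ℝ} (hx : 0 ≤ x) :
    IntegrableOn (fun s => p s * ∫ t in (0:ℝ)..φ s, q t) (Set.Ioc 0 x) := by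
  have hsub : Set.Ioc (0:ℝ) x ⊆ Set.Ici 0 := fun s hs => hs.1.le
  have hmeas : AEMeasurable φ (volume.restrict (Set.Ioc 0 x)) :=
    aemeasurable_restrict_of_monotoneOn measurableSet_Ioc (hφ.mono hsub)
  have hcont : Continuous fun b => ∫ t in (0:ℝ)..b, q t :=
    intervalIntegral.continuous_primitive hq 0
  have hpI : IntegrableOn p (Set.Ioc 0 x) :=
    (intervalIntegrable_iff_integrableOn_Ioc_of_le hx).1 (hp 0 x)
  refine Integrable.mul_bdd (c := ∫ t in (0:ℝ)..φ x, q t) hpI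
    (hcont.measurable.comp_aemeasurable hmeas).aestronglyMeasurable ?_
  filter_upwards [ae_restrict_mem measurableSet_Ioc] with s hs
  have hs0 := hφ0 s hs.1.le
  rw [Real.norm_of_nonneg (integral_nonneg hs0 fun t _ => hq0 t)]
  exact integral_mono_interval le_rfl hs0 (hφ (hsub hs) hx hs.2)
    (Eventually.of_forall hq0) (hq _ _)

lemma setIntegral_indicator_le_intervalIntegral {p : ℝ → ℝ}
    (hp : ∀ a b, IntervalIntegrable p volume a b) (hp0 : ∀ s, 0 ≤ p s)
    {S : Set ℝ} (hS : MeasurableSet S) {x b : ℝ} (hb : 0 ≤ b)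
    (hSb : ∀ s ∈ Set.Ioc 0 x, s ∈ S → s ≤ b) :
    ∫ s in Set.Ioc 0 x, S.indicator p s ≤ ∫ s in (0:ℝ)..b, p s := by
  rw [setIntegral_indicator hS, integral_of_le hb]
  exact setIntegral_mono_set ((intervalIntegrable_iff_integrableOn_Ioc_of_le hb).1 (hp 0 b))
    (Eventually.of_forall hp0)
    (Eventually.of_forall fun s hs => ⟨hs.1.1, hSb s hs.1 hs.2⟩)

/-- Weighted Young inequality for a pair of monotone functions whose sub- and supergraphs cover
the quadrant. -/
lemma integral_mul_integral_le_of_monotoneOn {p q φ ψ : ℝ → ℝ}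
    (hp : ∀ a b, IntervalIntegrable p volume a b) (hq : ∀ a b, IntervalIntegrable q volume a b)
    (hp0 : ∀ s, 0 ≤ p s) (hq0 : ∀ t, 0 ≤ q t)
    (hφ : MonotoneOn φ (Set.Ici 0)) (hφ0 : ∀ s, 0 ≤ s → 0 ≤ φ s)
    (hψ : MonotoneOn ψ (Set.Ici 0)) (hψ0 : ∀ t, 0 ≤ t → 0 ≤ ψ t)
    (hφψ : ∀ s t, 0 ≤ s → 0 ≤ t → φ s ≤ t → s ≤ ψ t)
    {x y : ℝ} (hx : 0 ≤ x) (hy : 0 ≤ y) :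
    (∫ s in (0:ℝ)..x, p s) * (∫ t in (0:ℝ)..y, q t) ≤
      (∫ s in (0:ℝ)..x, p s * ∫ t in (0:ℝ)..φ s, q t) +
        ∫ t in (0:ℝ)..y, q t * ∫ s in (0:ℝ)..ψ t, p s := by
  have hpI : IntegrableOn p (Set.Ioc 0 x) :=
    (intervalIntegrable_iff_integrableOn_Ioc_of_le hx).1 (hp 0 x)
  have hqI : IntegrableOn q (Set.Ioc 0 y) :=
    (intervalIntegrable_iff_integrableOn_Ioc_of_le hy).1 (hq 0 y)
  have hmono : Monotone fun s => φ (max s 0) := fun a b hab =>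
    hφ (Set.mem_Ici.2 (le_max_right a 0)) (Set.mem_Ici.2 (le_max_right b 0)) (max_le_max_right 0 hab)
  set A : Set (ℝ × ℝ) := {z | φ (max z.1 0) ≤ z.2}
  have hA : MeasurableSet A :=
    measurableSet_le (hmono.measurable.comp measurable_fst) measurable_snd
  have hint := hpI.mul_prod hqI
  rw [integral_of_le hx, integral_of_le hy, integral_of_le hx, integral_of_le hy,
    ← integral_prod_mul p q, ← integral_add_compl hA hint, add_comm,
    ← MeasureTheory.integral_indicator hA, ← MeasureTheory.integral_indicator hA.compl]
  refine add_le_add ?_ ?_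
  · rw [integral_prod _ (hint.indicator hA.compl)]
    refine integral_mono_ae (hint.indicator hA.compl).integral_prod_left
      (integrableOn_mul_integral_monotoneOn hp hq hq0 hφ hφ0 hx) ?_
    filter_upwards [ae_restrict_mem measurableSet_Ioc] with s hs
    have hslice : ∀ t, Aᶜ.indicator (fun z : ℝ × ℝ => p z.1 * q z.2) (s, t) =
        p s * (Set.Iio (φ s)).indicator q t := by
      intro t
      simp [A, Set.indicator_apply, max_eq_left hs.1.le]
    simp only [hslice, MeasureTheory.integral_const_mul]
    exact mul_le_mul_of_nonneg_left (setIntegral_indicator_le_intervalIntegral hq hq0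
      measurableSet_Iio (hφ0 s hs.1.le) fun t _ ht => le_of_lt ht) (hp0 s)
  · rw [integral_prod_symm _ (hint.indicator hA)]
    refine integral_mono_ae (hint.indicator hA).integral_prod_right
      (integrableOn_mul_integral_monotoneOn hq hp hp0 hψ hψ0 hy) ?_
    filter_upwards [ae_restrict_mem measurableSet_Ioc] with t ht
    have hslice : ∀ s, A.indicator (fun z : ℝ × ℝ => p z.1 * q z.2) (s, t) =
        q t * {s | φ (max s 0) ≤ t}.indicator p s := by
      intro s
      simp [A, Set.indicator_apply, mul_comm]
    simp only [hslice, MeasureTheory.integral_const_mul]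
    refine mul_le_mul_of_nonneg_left (setIntegral_indicator_le_intervalIntegral hp hp0
      (measurableSet_le hmono.measurable measurable_const) (hψ0 t ht.1.le) ?_) (hq0 t)
    intro s hs hst
    rw [Set.mem_ofPred_eq, max_eq_left hs.1.le] at hst
    exact hφψ s t hs.1.le ht.1.le hst

lemma intervalIntegrable_fract_one_div (a b : ℝ) :
    IntervalIntegrable (fun s : ℝ => Int.fract (1 / s)) volume a b := by
  refine (intervalIntegrable_const (c := (1:ℝ))).mono_fun
    (measurable_fract.comp (measurable_const.div measurable_id)).aestronglyMeasurable
    (Eventually.of_forall fun s => ?_)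
  beta_reduce
  rw [Real.norm_of_nonneg (Int.fract_nonneg _), norm_one]
  exact (Int.fract_lt_one _).le

/-- The fractional-part example of Theorem 4: with `{1/s}` the fractional part of `1/s`
(and `{1/0} = 0`, which holds since `1/0 = 0` in Lean),
`(∫_0^x {1/s} ds)(∫_0^y {1/t} dt) ≤ ∫_0^x {1/s} (∫_0^{f(s)} {1/t} dt) ds +
∫_0^y {1/t} (∫_0^{finv(t)} {1/s} ds) dt` for every nondecreasing `f` with `f 0 = 0`
and `f x → ∞`. -/
theorem young_inequality_fract (f finv : ℝ → ℝ)
    (hf_mono : MonotoneOn f (Set.Ici 0))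
    (hf_nonneg : ∀ x, 0 ≤ x → 0 ≤ f x)
    (hf0 : f 0 = 0)
    (hf_tendsto : Filter.Tendsto f Filter.atTop Filter.atTop)
    (hfinv : ∀ y, finv y = sInf {x : ℝ | 0 ≤ x ∧ y < f x})
    (x y : ℝ) (hx : 0 ≤ x) (hy : 0 ≤ y) :
    (∫ s in (0:ℝ)..x, Int.fract (1 / s)) * (∫ t in (0:ℝ)..y, Int.fract (1 / t)) ≤
      (∫ s in (0:ℝ)..x, Int.fract (1 / s) * ∫ t in (0:ℝ)..f s, Int.fract (1 / t)) +
        ∫ t in (0:ℝ)..y, Int.fract (1 / t) * ∫ s in (0:ℝ)..finv t, Int.fract (1 / s) := by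
  have hne : ∀ t, {x : ℝ | 0 ≤ x ∧ t < f x}.Nonempty := fun t =>
    ((eventually_ge_atTop 0).and (hf_tendsto.eventually_gt_atTop t)).exists
  refine integral_mul_integral_le_of_monotoneOn intervalIntegrable_fract_one_div
    intervalIntegrable_fract_one_div (fun _ => Int.fract_nonneg _) (fun _ => Int.fract_nonneg _)
    hf_mono hf_nonneg ?_ ?_ ?_ hx hy
  · intro a _ b _ hab
    rw [hfinv, hfinv]
    exact csInf_le_csInf ⟨0, fun _ h => h.1⟩ (hne b) fun _ h => ⟨h.1, hab.trans_lt h.2⟩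
  · intro t _
    rw [hfinv]
    exact le_csInf (hne t) fun _ h => h.1
  · intro s t hs _ hst
    rw [hfinv]
    refine le_csInf (hne t) fun r hr => ?_
    by_contra! hrs
    exact absurd (hf_mono hr.1 hs hrs.le) (hst.trans_lt hr.2).not_ge
end
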